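/- arXiv:2305.06469 — 2 statements merged into one kernel-verified Lean document; each statement's English description precedes it below -/
import Mathlib

section
/- Let X = [X_1,…,X_n] be a zero-mean jointly Gaussian random vector, where X_i takes values in ℝ^{d_i}, with joint covariance matrix Σ, and for each i let Σ_{−i} denote the covariance matrix of the concatenated vector [X_1,…,X_{i−1},X_{i+1},…,X_n] obtained by deleting X_i. Let D be the set of all k ∈ ℕ such that, on some probability space, there exist random vectors (X̃_1,…,X̃_n) with the same joint law as (X_1,…,X_n), a matrix G ∈ ℝ^{k×(d_1+⋯+d_n)}, and an ℕ-valued random variable V with finite Shannon entropy, such that X̃_1,…,X̃_n are mutually conditionally independent given the σ-algebra generated by (V, G·[X̃_1;…;X̃_n]). Then D is nonempty and min D = (∑_{i=1}^n rank(Σ_{−i})) − (n−1)·rank(Σ). -/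
noncomputable section

open MeasureTheory ProbabilityTheory in
/-- A random vector is (jointly) Gaussian if every linear functional of it has a
(possibly degenerate) Gaussian distribution on `ℝ`. -/
def IsGaussianVec {Ω : Type*} [MeasurableSpace Ω] (P : Measure Ω) {ι : Type*} [Fintype ι]
    (Z : Ω → ι → ℝ) : Prop :=
  ∀ a : ι → ℝ, ∃ (m : ℝ) (v : NNReal),
    P.map (fun ω => ∑ i, a i * Z ω i) = gaussianReal m v

open MeasureTheory in
/-- Finite Shannon entropy of an `ℕ`-valued random variable. -/
def HasFiniteEntropy {Ω : Type*} [MeasurableSpace Ω] (P : Measure Ω) (V : Ω → ℕ) : Prop :=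
  Summable fun n => Real.negMulLog (P (V ⁻¹' {n})).toReal

open MeasureTheory in
/-- Mutual conditional independence of a finite family of random vectors given a
sub-σ-algebra `m`: for all measurable sets `A i`,
`E[∏ᵢ 1_{Xᵢ ∈ Aᵢ} | m] = ∏ᵢ E[1_{Xᵢ ∈ Aᵢ} | m]` a.e. -/
def iCondIndepRV {Ω : Type*} [MeasurableSpace Ω] (P : Measure Ω)
    (m : MeasurableSpace Ω) {ι : Type*} [Fintype ι] {α : ι → Type*}
    [∀ i, MeasurableSpace (α i)] (X : ∀ i, Ω → α i) : Prop :=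
  ∀ (A : ∀ i, Set (α i)), (∀ i, MeasurableSet (A i)) →
    (P[(⋂ i, X i ⁻¹' A i).indicator (fun _ => (1 : ℝ)) | m]) =ᵐ[P]
      fun ω => ∏ i, (P[(X i ⁻¹' A i).indicator (fun _ => (1 : ℝ)) | m]) ω

/-- A witness that on some probability space there are random vectors `(X'_1, …, X'_n)`
with the same joint law as `(X_1, …, X_n)`, a matrix `G ∈ ℝ^{k × (d_1 + ⋯ + d_n)}`, and
an `ℕ`-valued random variable `V` of finite Shannon entropy, such that `X'_1, …, X'_n`
are mutually conditionally independent given the σ-algebra generated by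
`(V, G ⬝ [X'_1; …; X'_n])`. -/
structure SimWitnessN {Ω : Type*} [MeasurableSpace Ω] (P : MeasureTheory.Measure Ω)
    {n : ℕ} {d : Fin n → ℕ} (X : ∀ i, Ω → Fin (d i) → ℝ) (k : ℕ) : Type 1 where
  Ω' : Type
  [mΩ' : MeasurableSpace Ω']
  P' : MeasureTheory.Measure Ω'
  probP' : MeasureTheory.IsProbabilityMeasure P'
  X' : ∀ i, Ω' → Fin (d i) → ℝ
  V : Ω' → ℕ
  G : Matrix (Fin k) ((i : Fin n) × Fin (d i)) ℝ
  measX' : ∀ i, Measurable (X' i)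
  measV : Measurable V
  sameLaw : P'.map (fun ω i => X' i ω) = P.map (fun ω i => X i ω)
  finEnt : HasFiniteEntropy P' V
  condIndep : iCondIndepRV P'
    (MeasurableSpace.comap
      (fun ω => (V ω, G.mulVec (fun p => X' p.1 ω p.2))) inferInstance)
    X'

open MeasureTheory ProbabilityTheory Matrix

section LinearAlgebra

open Module Submodule

variable {H : Type*} [NormedAddCommGroup H] [InnerProductSpace ℝ H]

theorem finrank_span_eq_rank_gram {ι : Type*} [Fintype ι] (v : ι → H) :
    finrank ℝ (span ℝ (Set.range v)) = (gram ℝ v).rank := by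
  classical
  have hker : LinearMap.ker (gram ℝ v).mulVecLin =
      LinearMap.ker (Fintype.linearCombination ℝ v) := by
    ext r
    simp only [LinearMap.mem_ker, mulVecLin_apply, Fintype.linearCombination_apply]
    constructor
    · intro h
      have := star_dotProduct_gram_mulVec v r r
      rw [h, dotProduct_zero] at this
      exact inner_self_eq_zero.1 this.symm
    · intro h
      refine dotProduct_eq_zero _ fun w => ?_
      have := star_dotProduct_gram_mulVec v w r
      rwa [h, inner_zero_right, star_trivial, dotProduct_comm] at this
  have h1 := LinearMap.finrank_range_add_finrank_ker (gram ℝ v).mulVecLin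
  have h2 := LinearMap.finrank_range_add_finrank_ker (Fintype.linearCombination ℝ v)
  rw [hker] at h1
  rw [Fintype.range_linearCombination] at h2
  rw [Matrix.rank]
  omega

theorem iSupIndep.linearIndependent_finBasis {β : Type*} [Fintype β] {T : β → Submodule ℝ H}
    [∀ i, FiniteDimensional ℝ (T i)] (h : iSupIndep T) :
    LinearIndependent ℝ fun x : (i : β) × Fin (finrank ℝ (T i)) =>
      ((finBasis ℝ (T x.1) x.2 : T x.1) : H) := by
  classical
  rw [Fintype.linearIndependent_iff]
  intro g hg
  rw [iSupIndep_iff_finsetSum_eq_zero_imp_eq_zero] at h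
  rw [Fintype.sum_sigma] at hg
  rintro ⟨i, x⟩
  have := h Finset.univ (fun i => ∑ x, g ⟨i, x⟩ • ((finBasis ℝ (T i) x : T i) : H))
    (fun i _ => sum_mem fun x _ => smul_mem _ _ (finBasis ℝ (T i) x).2) hg i (Finset.mem_univ i)
  have h2 : ∑ x, g ⟨i, x⟩ • finBasis ℝ (T i) x = 0 := by
    apply Subtype.ext
    simpa using this
  exact Fintype.linearIndependent_iff.1 (finBasis ℝ (T i)).linearIndependent _ h2 x

theorem iSupIndep.span_range_finBasis {β : Type*} [Fintype β] (T : β → Submodule ℝ H)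
    [∀ i, FiniteDimensional ℝ (T i)] :
    span ℝ (Set.range fun x : (i : β) × Fin (finrank ℝ (T i)) =>
      ((finBasis ℝ (T x.1) x.2 : T x.1) : H)) = ⨆ i, T i := by
  apply le_antisymm
  · rw [span_le]
    rintro _ ⟨x, rfl⟩
    exact mem_iSup_of_mem x.1 (finBasis ℝ (T x.1) x.2).2
  · refine iSup_le fun i y hy => ?_
    have := (finBasis ℝ (T i)).sum_repr ⟨y, hy⟩
    have h2 : ∑ x, (finBasis ℝ (T i)).repr ⟨y, hy⟩ x • ((finBasis ℝ (T i) x : T i) : H) = y := by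
      simpa only [map_sum, map_smul, subtype_apply] using congrArg (T i).subtype this
    rw [← h2]
    exact sum_mem fun x _ => smul_mem _ _ (subset_span ⟨⟨i, x⟩, rfl⟩)

theorem iSupIndep.sum_finrank {β : Type*} [Fintype β] {T : β → Submodule ℝ H}
    [∀ i, FiniteDimensional ℝ (T i)] (h : iSupIndep T) :
    ∑ i, finrank ℝ (T i) = finrank ℝ (⨆ i, T i : Submodule ℝ H) := by
  rw [← iSupIndep.span_range_finBasis T, finrank_span_eq_card h.linearIndependent_finBasis]
  simp

variable {β : Type*} (S : β → Submodule ℝ H)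

/-- The sum of all subspaces of the family but the one of index `i`. -/
def supOthers (i : β) : Submodule ℝ H := ⨆ j, ⨆ (_ : j ≠ i), S j

theorem le_supOthers {i j : β} (h : j ≠ i) : S j ≤ supOthers S i :=
  le_iSup₂_of_le j h le_rfl

theorem supOthers_le_iSup (i : β) : supOthers S i ≤ ⨆ j, S j :=
  iSup₂_le fun j _ => le_iSup S j

theorem sup_supOthers (i : β) : S i ⊔ supOthers S i = ⨆ j, S j := by
  apply le_antisymm (sup_le (le_iSup S i) (supOthers_le_iSup S i))
  refine iSup_le fun j => ?_
  by_cases h : j = i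
  · exact h ▸ le_sup_left
  · exact le_sup_of_le_right (le_supOthers S h)

/-- The images of the family under the projection that kills `L`. -/
def projFamily (L : Submodule ℝ H) [L.HasOrthogonalProjection] (i : β) : Submodule ℝ H :=
  (S i).map (Lᗮ.starProjection : H →ₗ[ℝ] H)

variable [FiniteDimensional ℝ H]

theorem starProjection_orthogonal_eq_sub (L : Submodule ℝ H) (x : H) :
    Lᗮ.starProjection x = x - L.starProjection x := by
  rw [starProjection_orthogonal]; rfl

theorem iSupIndep_projFamily_iInf :
    iSupIndep (projFamily S (⨅ i, supOthers S i)) := by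
  set W := ⨅ i, supOthers S i with hW
  intro i
  have hmap : (⨆ j, ⨆ (_ : j ≠ i), projFamily S W j) =
      (supOthers S i).map (Wᗮ.starProjection : H →ₗ[ℝ] H) := by
    simp only [supOthers, projFamily, Submodule.map_iSup]
  rw [hmap, disjoint_def]
  rintro _ ⟨s, hs, rfl⟩ ⟨t, ht, hts⟩
  have hWle : ∀ j, W ≤ supOthers S j := fun j => iInf_le _ j
  simp only [ContinuousLinearMap.coe_coe] at hts ⊢
  have h1 : Wᗮ.starProjection s ∈ W := by
    rw [hW, mem_iInf]
    intro j
    by_cases hj : j = i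
    · rw [← hts, starProjection_orthogonal_eq_sub, hj]
      exact sub_mem ht (hWle i (starProjection_apply_mem W t))
    · rw [starProjection_orthogonal_eq_sub]
      exact sub_mem (le_supOthers S (Ne.symm hj) hs) (hWle j (starProjection_apply_mem W s))
  have h2 : Wᗮ.starProjection s ∈ Wᗮ := starProjection_apply_mem _ _
  exact disjoint_def.1 (orthogonal_disjoint W) _ h1 h2


theorem le_sup_projFamily (L : Submodule ℝ H) (i : β) : S i ≤ L ⊔ projFamily S L i := by
  intro x hx
  have h : x = L.starProjection x + Lᗮ.starProjection x := by
    rw [starProjection_orthogonal_eq_sub, add_sub_cancel]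
  rw [h]
  exact add_mem (mem_sup_left (starProjection_apply_mem _ _))
    (mem_sup_right (mem_map_of_mem hx))

theorem finrank_iInf_supOthers_le [Fintype β] [Nonempty β] :
    finrank ℝ (⨅ i, supOthers S i : Submodule ℝ H) +
        Fintype.card β * finrank ℝ (⨆ i, S i : Submodule ℝ H) ≤
      (∑ i, finrank ℝ (supOthers S i)) + finrank ℝ (⨆ i, S i : Submodule ℝ H) := by
  set W := ⨅ i, supOthers S i with hW
  have hind := iSupIndep_projFamily_iInf S
  rw [← hW] at hind
  have hWS : W ≤ ⨆ i, S i :=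
    (iInf_le _ (Classical.arbitrary β)).trans (supOthers_le_iSup S _)
  have h1 : ∀ i, finrank ℝ (⨆ i, S i : Submodule ℝ H) ≤
      finrank ℝ (supOthers S i) + finrank ℝ (projFamily S W i) := fun i => by
    refine (finrank_mono ?_).trans (finrank_add_le_finrank_add_finrank _ _)
    rw [← sup_supOthers S i]
    refine sup_le ((le_sup_projFamily S W i).trans ?_) le_sup_left
    exact sup_le_sup_right (iInf_le _ i) _
  have h2 : finrank ℝ W + finrank ℝ (⨆ i, projFamily S W i : Submodule ℝ H) ≤
      finrank ℝ (⨆ i, S i : Submodule ℝ H) := by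
    have hdisj : Disjoint W (⨆ i, projFamily S W i) := by
      refine (orthogonal_disjoint W).mono_right (iSup_le fun i => ?_)
      rintro _ ⟨x, -, rfl⟩
      exact starProjection_apply_mem _ _
    rw [← finrank_sup_add_finrank_inf_eq W, hdisj.eq_bot, finrank_bot, add_zero]
    refine finrank_mono (sup_le hWS (iSup_le fun i => ?_))
    rintro _ ⟨x, hx, rfl⟩
    rw [ContinuousLinearMap.coe_coe, starProjection_orthogonal_eq_sub]
    exact sub_mem (le_iSup S i hx) (hWS (starProjection_apply_mem _ _))
  rw [← hind.sum_finrank] at h2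
  have h3 := Finset.sum_le_sum fun i (_ : i ∈ Finset.univ) => h1 i
  rw [Finset.sum_const, Finset.sum_add_distrib, Finset.card_univ, smul_eq_mul] at h3
  omega

theorem sum_finrank_supOthers_le [Fintype β] (L : Submodule ℝ H)
    (hL : ∀ i, ∀ x ∈ S i, ∀ y ∈ supOthers S i, x - y ∈ L → x ∈ L) :
    (∑ i, finrank ℝ (supOthers S i)) + finrank ℝ (⨆ i, S i : Submodule ℝ H) ≤
      finrank ℝ L + Fintype.card β * finrank ℝ (⨆ i, S i : Submodule ℝ H) := by
  have hind : iSupIndep (projFamily S L) := by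
    intro i
    have hmap : (⨆ j, ⨆ (_ : j ≠ i), projFamily S L j) =
        (supOthers S i).map (Lᗮ.starProjection : H →ₗ[ℝ] H) := by
      simp only [supOthers, projFamily, Submodule.map_iSup]
    rw [hmap, disjoint_def]
    rintro _ ⟨s, hs, rfl⟩ ⟨t, ht, hts⟩
    have h1 : Lᗮ.starProjection (s - t) = 0 := by
      rw [map_sub, sub_eq_zero]; exact hts.symm
    have h2 := hL i s hs t ht
      (by rwa [starProjection_apply_eq_zero_iff, orthogonal_orthogonal] at h1)
    rw [ContinuousLinearMap.coe_coe, starProjection_apply_eq_zero_iff, orthogonal_orthogonal]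
    exact h2
  have h1 : ∀ i, finrank ℝ (projFamily S L i) + finrank ℝ (supOthers S i) ≤
      finrank ℝ (⨆ i, S i : Submodule ℝ H) := fun i => by
    have ha := finrank_sup_add_finrank_inf_eq (S i) (supOthers S i)
    rw [sup_supOthers] at ha
    have hb := LinearMap.finrank_range_add_finrank_ker
      ((Lᗮ.starProjection : H →ₗ[ℝ] H).domRestrict (S i))
    rw [LinearMap.range_domRestrict] at hb
    have hc : finrank ℝ (S i ⊓ supOthers S i : Submodule ℝ H) ≤
        finrank ℝ (LinearMap.ker ((Lᗮ.starProjection : H →ₗ[ℝ] H).domRestrict (S i))) := by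
      rw [LinearMap.ker_domRestrict, ← finrank_map_subtype_eq (S i)]
      refine finrank_mono ?_
      rintro x ⟨hx, hx'⟩
      refine ⟨⟨x, hx⟩, ?_, rfl⟩
      have := hL i x hx x hx' (by simp)
      simpa [starProjection_apply_eq_zero_iff] using this
    unfold projFamily
    omega
  have h2 : finrank ℝ (⨆ i, S i : Submodule ℝ H) ≤
      finrank ℝ L + finrank ℝ (⨆ i, projFamily S L i : Submodule ℝ H) := by
    refine (finrank_mono (iSup_le fun i => ?_)).trans (finrank_add_le_finrank_add_finrank _ _)
    exact (le_sup_projFamily S L i).trans (sup_le_sup_left (le_iSup _ i) _)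
  rw [← hind.sum_finrank] at h2
  have h3 := Finset.sum_le_sum fun i (_ : i ∈ Finset.univ) => h1 i
  rw [Finset.sum_const, Finset.sum_add_distrib, Finset.card_univ, smul_eq_mul] at h3
  omega

theorem exists_factorization_gram {ι : Type*} [Fintype ι] [Fintype β] [Nonempty β]
    (a : ι → H) (blk : ι → β)
    (hS : ∀ i, S i = span ℝ (a '' {p | blk p = i})) :
    ∃ (m : ℕ) (c : Fin m → β)
      (B : Matrix ι (Fin (finrank ℝ (⨅ i, supOthers S i : Submodule ℝ H))) ℝ)
      (M : Matrix ι (Fin m) ℝ) (Γ : Matrix (Fin m) (Fin m) ℝ)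
      (G : Matrix (Fin (finrank ℝ (⨅ i, supOthers S i : Submodule ℝ H))) ι ℝ),
      Γ.PosDef ∧ (∀ p j, c j ≠ blk p → M p j = 0) ∧ G * B = 1 ∧ G * M = 0 ∧
        gram ℝ a = B * Bᵀ + M * Γ * Mᵀ := by
  classical
  set W := ⨅ i, supOthers S i with hW
  have hind := iSupIndep_projFamily_iInf S
  rw [← hW] at hind
  set T := projFamily S W with hT
  have hb := hind.linearIndependent_finBasis
  set b := fun x : (i : β) × Fin (finrank ℝ (T i)) => ((finBasis ℝ (T x.1) x.2 : T x.1) : H)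
    with hbdef
  let e := Fintype.equivFin ((i : β) × Fin (finrank ℝ (T i)))
  let o := stdOrthonormalBasis ℝ W
  have haT : ∀ p, Wᗮ.starProjection (a p) ∈ T (blk p) := fun p => by
    refine mem_map_of_mem ?_
    rw [hS]
    exact subset_span ⟨p, rfl, rfl⟩
  obtain ⟨M, hM0, hM⟩ : ∃ M : Matrix ι ((i : β) × Fin (finrank ℝ (T i))) ℝ,
      (∀ p x, x.1 ≠ blk p → M p x = 0) ∧
        ∀ p, ∑ x, M p x • b x = Wᗮ.starProjection (a p) := by
    refine ⟨Matrix.of fun p x => if h : x.1 = blk p then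
      (finBasis ℝ (T (blk p))).repr ⟨_, haT p⟩ (h ▸ x.2) else 0,
      fun p x hx => by rw [of_apply, dif_neg hx], fun p => ?_⟩
    rw [Fintype.sum_sigma, Finset.sum_eq_single (blk p)]
    · have := congrArg (T (blk p)).subtype ((finBasis ℝ (T (blk p))).sum_repr ⟨_, haT p⟩)
      simpa only [map_sum, map_smul, subtype_apply, of_apply, dif_pos, hbdef] using this
    · intro i _ hi
      exact Finset.sum_eq_zero fun x _ => by simp [hi]
    · simp
  have hWS : W ≤ span ℝ (Set.range a) := by
    refine ((iInf_le _ (Classical.arbitrary β)).trans (supOthers_le_iSup S _)).trans ?_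
    refine iSup_le fun i => ?_
    rw [hS]
    exact span_mono (Set.image_subset_range _ _)
  obtain ⟨G, hG⟩ : ∃ G : Matrix (Fin (finrank ℝ W)) ι ℝ,
      ∀ j, ∑ p, G j p • a p = (o j : H) := by
    have this : ∀ j, ∃ g : ι → ℝ, ∑ p, g p • a p = (o j : H) := by
      intro j
      have := hWS (o j).2
      rwa [mem_span_range_iff_exists_fun] at this
    choose g hg using this
    exact ⟨Matrix.of g, hg⟩
  obtain ⟨B, hB⟩ : ∃ B : Matrix ι (Fin (finrank ℝ W)) ℝ,
      ∀ p j, B p j = inner ℝ (a p) (o j : H) := ⟨Matrix.of _, fun _ _ => rfl⟩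
  refine ⟨_, fun j => (e.symm j).1, B, M.submatrix id e.symm,
    gram ℝ (b ∘ e.symm), G, ?_, fun p j hj => hM0 p _ hj, ?_, ?_, ?_⟩
  · exact posDef_gram_of_linearIndependent (hb.comp _ e.symm.injective)
  · ext j l
    simp only [mul_apply, hB]
    have := congrArg (fun z => inner ℝ z (o l : H)) (hG j)
    simp only [sum_inner, real_inner_smul_left] at this
    rw [this]
    have h2 := orthonormal_iff_ite.1 o.orthonormal j l
    rw [Submodule.coe_inner] at h2
    rw [h2, Matrix.one_apply]
  · have key : ∀ j x, (∑ p, G j p * M p x) = 0 := by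
      intro j
      refine Fintype.linearIndependent_iff.1 hb _ ?_
      simp only [Finset.sum_smul, mul_smul]
      rw [Finset.sum_comm]
      simp only [← Finset.smul_sum, hM]
      have := congrArg Wᗮ.starProjection (hG j)
      rw [map_sum] at this
      simp only [map_smul] at this
      rw [this, starProjection_apply_eq_zero_iff, orthogonal_orthogonal]
      exact (o j).2
    ext j x
    simpa [mul_apply] using key j (e.symm x)
  · ext p q
    have hsplit : (inner ℝ (a p) (a q) : ℝ) =
        inner ℝ (W.starProjection (a p)) (W.starProjection (a q))
        + inner ℝ (Wᗮ.starProjection (a p)) (Wᗮ.starProjection (a q)) := by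
      have h : ∀ x, x = W.starProjection x + Wᗮ.starProjection x := fun x => by
        rw [starProjection_orthogonal_eq_sub, add_sub_cancel]
      conv_lhs => rw [h (a p), h (a q)]
      have h1 := inner_right_of_mem_orthogonal (starProjection_apply_mem W (a p))
        (starProjection_apply_mem Wᗮ (a q))
      have h2 := inner_left_of_mem_orthogonal (starProjection_apply_mem W (a q))
        (starProjection_apply_mem Wᗮ (a p))
      rw [inner_add_left, inner_add_right, inner_add_right, h1, h2]
      ring
    rw [gram_apply, hsplit, Matrix.add_apply]
    congr 1
    · rw [starProjection_apply, starProjection_apply, ← Submodule.coe_inner,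
        ← o.sum_inner_mul_inner]
      simp only [mul_apply, transpose_apply, hB]
      refine Finset.sum_congr rfl fun j _ => ?_
      rw [inner_orthogonalProjectionOnto_eq_of_mem_right,
        inner_orthogonalProjectionOnto_eq_of_mem_left, real_inner_comm (a q)]
    · rw [← hM p, ← hM q, ← e.symm.sum_comp, ← e.symm.sum_comp]
      simp only [sum_inner, inner_sum, real_inner_smul_left, real_inner_smul_right, mul_apply,
        transpose_apply, submatrix_apply, gram_apply, Function.comp, id, Finset.sum_mul]
      refine Finset.sum_congr rfl fun j _ => Finset.sum_congr rfl fun l _ => ?_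
      rw [real_inner_comm]
      ring

end LinearAlgebra

section Mixture

open Real

theorem Real.negMulLog_le_mul_add_exp {x : ℝ} (hx : 0 ≤ x) (t : ℝ) :
    negMulLog x ≤ x * t + exp (-t) := by
  rcases hx.eq_or_lt with rfl | hx
  · simpa using (exp_pos (-t)).le
  · have h := add_one_le_exp (-t - log x)
    rw [exp_sub, exp_log hx, le_div_iff₀ hx] at h
    rw [negMulLog]
    nlinarith

/-- The arctangent, rescaled to take its values in `(0, 1)`. -/
def unitArctan (x : ℝ) : ℝ := (arctan x + π / 2) / π

theorem unitArctan_pos (x : ℝ) : 0 < unitArctan x := by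
  have := neg_pi_div_two_lt_arctan x
  exact div_pos (by linarith) pi_pos

theorem unitArctan_lt_one (x : ℝ) : unitArctan x < 1 := by
  have := arctan_lt_pi_div_two x
  rw [unitArctan, div_lt_one pi_pos]
  linarith

/-- The index, among the `2 ^ k` dyadic intervals of length `2 ^ (-k)` of `(0, 1)`, of the one that
contains `unitArctan x`. -/
def dyadicCell (k : ℕ) (x : ℝ) : Fin (2 ^ k) :=
  ⟨⌊2 ^ k * unitArctan x⌋₊, by
    rw [Nat.floor_lt (by have := unitArctan_pos x; positivity)]
    push_cast
    exact mul_lt_of_lt_one_right (by positivity) (unitArctan_lt_one x)⟩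

theorem measurable_dyadicCell (k : ℕ) : Measurable (dyadicCell k) := by
  refine measurable_to_countable' fun q => ?_
  have : dyadicCell k ⁻¹' {q} = (fun x => ⌊2 ^ k * unitArctan x⌋₊) ⁻¹' {(q : ℕ)} := by
    ext x
    simp [dyadicCell, Fin.ext_iff]
  rw [this]
  refine Nat.measurable_floor.comp ?_ (measurableSet_singleton _)
  unfold unitArctan
  fun_prop

theorem dyadicCell_succ {k : ℕ} {x y : ℝ} (h : dyadicCell (k + 1) x = dyadicCell (k + 1) y) :
    dyadicCell k x = dyadicCell k y := by
  have key : ∀ z, (dyadicCell k z : ℕ) = dyadicCell (k + 1) z / 2 := fun z => by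
    simp only [dyadicCell]
    rw [← Nat.floor_div_ofNat]
    congr 1
    rw [pow_succ]
    ring
  rw [Fin.ext_iff, key, key, h]

theorem abs_arctan_sub_le_of_dyadicCell {k : ℕ} {x y : ℝ} (h : dyadicCell k x = dyadicCell k y) :
    |arctan x - arctan y| ≤ π * (2 ^ k)⁻¹ := by
  have hx := unitArctan_pos x
  have hy := unitArctan_pos y
  have h1 : ⌊2 ^ k * unitArctan x⌋₊ = ⌊2 ^ k * unitArctan y⌋₊ := congrArg Fin.val h
  have a1 := Nat.floor_le (show 0 ≤ 2 ^ k * unitArctan x by positivity)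
  have a2 := Nat.lt_floor_add_one (2 ^ k * unitArctan x)
  have b1 := Nat.floor_le (show 0 ≤ 2 ^ k * unitArctan y by positivity)
  have b2 := Nat.lt_floor_add_one (2 ^ k * unitArctan y)
  rw [h1] at a1 a2
  have h2 : |2 ^ k * unitArctan x - 2 ^ k * unitArctan y| ≤ 1 := by
    rw [abs_le]; constructor <;> linarith
  rw [← mul_sub, abs_mul, abs_of_pos (by positivity : (0 : ℝ) < 2 ^ k)] at h2
  have h3 : arctan x - arctan y = π * (unitArctan x - unitArctan y) := by
    unfold unitArctan
    field_simp
    ring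
  rw [h3, abs_mul, abs_of_pos pi_pos]
  refine mul_le_mul_of_nonneg_left ?_ pi_pos.le
  rwa [← one_div, le_div_iff₀ (by positivity), mul_comm]

theorem exists_dyadic_increments {m : ℕ} {φ : (Fin m → ℝ) → ℝ} {B : ℝ} (hφ : ∀ x, 0 ≤ φ x)
    (hφB : ∀ x, φ x ≤ B)
    (hLip : ∀ x y D, 0 ≤ D → (∀ j, |arctan (x j) - arctan (y j)| ≤ D) → |φ x - φ y| ≤ B * D) :
    ∃ (a : ∀ k, (Fin m → Fin (2 ^ k)) → ℝ) (C : ℝ), 0 ≤ C ∧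
      (∀ k Q, 0 ≤ a k Q) ∧ (∀ k Q, a k Q ≤ C * (2 ^ k)⁻¹) ∧
      ∀ x, HasSum (fun k => a k fun j => dyadicCell k (x j)) (φ x) := by
  have hB : 0 ≤ B := (hφ 0).trans (hφB 0)
  let F : ∀ k, (Fin m → Fin (2 ^ k)) → ℝ := fun k Q =>
    ⨅ y : {y : Fin m → ℝ // (fun j => dyadicCell k (y j)) = Q}, φ y
  have hbdd : ∀ k Q, BddBelow (Set.range
      fun y : {y : Fin m → ℝ // (fun j => dyadicCell k (y j)) = Q} => φ y) := fun k Q =>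
    ⟨0, by rintro _ ⟨y, rfl⟩; exact hφ _⟩
  have hF0 : ∀ k Q, 0 ≤ F k Q := fun k Q => Real.iInf_nonneg fun y => hφ _
  have hFle : ∀ k x, F k (fun j => dyadicCell k (x j)) ≤ φ x := fun k x =>
    ciInf_le (hbdd k _) ⟨x, rfl⟩
  have hleF : ∀ k x, φ x - B * (π * (2 ^ k)⁻¹) ≤ F k (fun j => dyadicCell k (x j)) := by
    intro k x
    have : Nonempty {y : Fin m → ℝ // (fun j => dyadicCell k (y j)) =
        fun j => dyadicCell k (x j)} :=
      ⟨⟨x, rfl⟩⟩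
    refine le_ciInf fun y => ?_
    have := hLip x y.1 _ (by positivity) fun j =>
      abs_arctan_sub_le_of_dyadicCell (congrFun y.2 j).symm
    linarith [(abs_le.1 this).2]
  have hmono : ∀ k (x : Fin m → ℝ), F k (fun j => dyadicCell k (x j)) ≤
      F (k + 1) (fun j => dyadicCell (k + 1) (x j)) := by
    intro k x
    have : Nonempty {y : Fin m → ℝ //
        (fun j => dyadicCell (k + 1) (y j)) = fun j => dyadicCell (k + 1) (x j)} := ⟨⟨x, rfl⟩⟩
    exact le_ciInf fun y => ciInf_le (hbdd k _)
      ⟨y.1, funext fun j => dyadicCell_succ (congrFun y.2 j)⟩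
  let Δ : ℕ → (Fin m → ℝ) → ℝ := fun k x => F k (fun j => dyadicCell k (x j)) -
    if k = 0 then 0 else F (k - 1) (fun j => dyadicCell (k - 1) (x j))
  have hΔcongr : ∀ k x y, (∀ j, dyadicCell k (x j) = dyadicCell k (y j)) → Δ k x = Δ k y := by
    intro k x y h
    cases k with
    | zero => simp [Δ, h]
    | succ k => simp [Δ, h, fun j => dyadicCell_succ (h j)]
  have hΔ0 : ∀ k x, 0 ≤ Δ k x := by
    intro k x
    cases k with
    | zero => simpa [Δ] using hF0 0 _
    | succ k => simpa [Δ] using hmono k x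
  have hΔle : ∀ k x, Δ k x ≤ (B + 2 * B * π) * (2 ^ k)⁻¹ := by
    intro k x
    cases k with
    | zero =>
      have := hFle 0 x
      have := hφB x
      have : 0 ≤ B * π := by positivity
      simp only [Δ]
      norm_num
      linarith
    | succ k =>
      have h1 := hFle (k + 1) x
      have h2 := hleF k x
      have h3 : 0 ≤ B * (2 ^ (k + 1) : ℝ)⁻¹ := by positivity
      have h4 : B * (π * (2 ^ k)⁻¹) = 2 * B * π * (2 ^ (k + 1))⁻¹ := by
        rw [pow_succ]
        field_simp
      have h5 : Δ (k + 1) x = F (k + 1) (fun j => dyadicCell (k + 1) (x j)) -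
          F k (fun j => dyadicCell k (x j)) := by simp [Δ]
      rw [h5]
      linarith
  have hsum : ∀ x, HasSum (fun k => Δ k x) (φ x) := by
    intro x
    rw [hasSum_iff_tendsto_nat_of_nonneg fun k => hΔ0 k x,
      ← Filter.tendsto_add_atTop_iff_nat 1]
    have hs : ∀ n, ∑ i ∈ Finset.range (n + 1), Δ i x = F n (fun j => dyadicCell n (x j)) := by
      intro n
      induction n with
      | zero => simp [Δ]
      | succ n ih => rw [Finset.sum_range_succ, ih]; simp [Δ]
    simp only [hs]
    refine tendsto_of_tendsto_of_tendsto_of_le_of_le (g := fun k : ℕ => φ x - B * (π * (2 ^ k)⁻¹))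
      ?_ tendsto_const_nhds (fun k => hleF k x) (fun k => hFle k x)
    have h := (tendsto_inv_atTop_zero.comp (tendsto_pow_atTop_atTop_of_one_lt
      (one_lt_two : (1 : ℝ) < 2)))
    simpa using tendsto_const_nhds.sub ((h.const_mul π).const_mul B)
  classical
  refine ⟨fun k Q => if h : ∃ x : Fin m → ℝ, (fun j => dyadicCell k (x j)) = Q then Δ k h.choose
    else 0, B + 2 * B * π, by positivity, fun k Q => ?_, fun k Q => ?_, fun x => ?_⟩
  · dsimp only
    split_ifs
    exacts [hΔ0 _ _, le_rfl]
  · dsimp only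
    split_ifs
    exacts [hΔle _ _, by positivity]
  · convert hsum x using 2 with k
    have h : ∃ y : Fin m → ℝ, (fun j => dyadicCell k (y j)) = fun j => dyadicCell k (x j) :=
      ⟨x, rfl⟩
    dsimp only
    rw [dif_pos h]
    exact hΔcongr _ _ _ fun j => congrFun h.choose_spec j


theorem summable_negMulLog_dyadic {m : ℕ} {ν : Measure ℝ} [IsProbabilityMeasure ν]
    {a : ∀ k, (Fin m → Fin (2 ^ k)) → ℝ} {C : ℝ} (hC : 0 ≤ C) (ha0 : ∀ k Q, 0 ≤ a k Q)
    (haC : ∀ k Q, a k Q ≤ C * (2 ^ k)⁻¹)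
    (hle1 : ∀ k Q, a k Q * ∏ j, ν.real (dyadicCell k ⁻¹' {Q j}) ≤ 1) :
    Summable fun v : Σ k, (Fin m → Fin (2 ^ k)) =>
      negMulLog (a v.1 v.2 * ∏ j, ν.real (dyadicCell v.1 ⁻¹' {v.2 j})) := by
  have hp0 : ∀ k (Q : Fin m → Fin (2 ^ k)), 0 ≤ ∏ j, ν.real (dyadicCell k ⁻¹' {Q j}) :=
    fun k Q => Finset.prod_nonneg fun _ _ => measureReal_nonneg
  have hp1 : ∀ k, ∑ Q : Fin m → Fin (2 ^ k), ∏ j, ν.real (dyadicCell k ⁻¹' {Q j}) = 1 := by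
    intro k
    have h : ∑ q : Fin (2 ^ k), ν.real (dyadicCell k ⁻¹' {q}) = 1 := by
      rw [sum_measureReal_preimage_singleton _ fun q _ =>
        measurable_dyadicCell k (measurableSet_singleton q)]
      simp
    rw [← Fintype.prod_sum (fun (_ : Fin m) q => ν.real (dyadicCell k ⁻¹' {q}))]
    simp [h]
  have hnn : ∀ v : Σ k, (Fin m → Fin (2 ^ k)), 0 ≤
      negMulLog (a v.1 v.2 * ∏ j, ν.real (dyadicCell v.1 ⁻¹' {v.2 j})) := fun v =>
    negMulLog_nonneg (mul_nonneg (ha0 _ _) (hp0 _ _)) (hle1 _ _)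
  rw [summable_sigma_of_nonneg hnn]
  refine ⟨fun k => Summable.of_finite, ?_⟩
  have hbound : ∀ k, ∑' Q : Fin m → Fin (2 ^ k),
      negMulLog (a k Q * ∏ j, ν.real (dyadicCell k ⁻¹' {Q j})) ≤
        C * (m + 1) * log 2 * (k * (1 / 2) ^ k) + (1 / 2) ^ k := by
    intro k
    rw [tsum_fintype]
    calc _ ≤ ∑ Q : Fin m → Fin (2 ^ k), (C * (2 ^ k)⁻¹ * (∏ j, ν.real (dyadicCell k ⁻¹' {Q j})) *
            (k * (m + 1) * log 2) + exp (-(k * (m + 1) * log 2))) := by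
          refine Finset.sum_le_sum fun Q _ =>
            (negMulLog_le_mul_add_exp (mul_nonneg (ha0 _ _) (hp0 _ _))
              (k * (m + 1) * log 2)).trans ?_
          have : 0 ≤ log 2 := log_nonneg (by norm_num)
          gcongr
          exact haC _ _
      _ = _ := by
          have he : exp (-(k * (m + 1) * log 2)) = ((2 : ℝ) ^ (k * (m + 1)))⁻¹ := by
            rw [Real.exp_neg, ← exp_log (by positivity : (0 : ℝ) < 2 ^ (k * (m + 1))), log_pow]
            push_cast
            rfl
          rw [Finset.sum_add_distrib, ← Finset.sum_mul, ← Finset.mul_sum, hp1, he]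
          simp only [Finset.sum_const, Finset.card_univ, Fintype.card_pi, Fintype.card_fin,
            Finset.prod_const, nsmul_eq_mul]
          push_cast
          rw [one_div, inv_pow, pow_mul, pow_succ]
          field_simp
  refine Summable.of_nonneg_of_le (fun k => tsum_nonneg fun Q => hnn ⟨k, Q⟩) hbound ?_
  refine Summable.add (Summable.mul_left _ ?_)
    (summable_geometric_of_lt_one (by norm_num) (by norm_num))
  simpa using summable_pow_mul_geometric_of_norm_lt_one 1 (r := (1 / 2 : ℝ)) (by norm_num)

/-- A measure whose density relative to a product measure is regular enough is a mixture of
product measures, with mixing weights of finite entropy. -/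
theorem exists_discrete_product_mixture {m : ℕ} {μ : Measure (Fin m → ℝ)} [IsProbabilityMeasure μ]
    {ν : Measure ℝ} [IsProbabilityMeasure ν] {φ : (Fin m → ℝ) → ℝ} {B : ℝ}
    (hμ : μ = (Measure.pi fun _ => ν).withDensity fun x => ENNReal.ofReal (φ x))
    (hφ : ∀ x, 0 ≤ φ x) (hφB : ∀ x, φ x ≤ B)
    (hLip : ∀ x y D, 0 ≤ D → (∀ j, |arctan (x j) - arctan (y j)| ≤ D) → |φ x - φ y| ≤ B * D) :
    ∃ (ρ : Measure ℕ) (κ : ℕ → Fin m → Measure ℝ), IsProbabilityMeasure ρ ∧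
      (∀ n j, IsProbabilityMeasure (κ n j)) ∧
      (Summable fun n => negMulLog (ρ {n}).toReal) ∧
      ∀ A : Fin m → Set ℝ, (∀ j, MeasurableSet (A j)) →
        μ (Set.univ.pi A) = ∑' n, ρ {n} * ∏ j, κ n j (A j) := by
  obtain ⟨a, C, hC, ha0, haC, hsum⟩ := exists_dyadic_increments hφ hφB hLip
  let w : (Σ k, (Fin m → Fin (2 ^ k))) → ENNReal := fun v =>
    ENNReal.ofReal (a v.1 v.2) * ∏ j, ν (dyadicCell v.1 ⁻¹' {v.2 j})
  let R : (Σ k, (Fin m → Fin (2 ^ k))) → Fin m → Set ℝ := fun v j => dyadicCell v.1 ⁻¹' {v.2 j}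
  have hR : ∀ v j, MeasurableSet (R v j) := fun v j =>
    measurable_dyadicCell v.1 (measurableSet_singleton _)
  classical
  let θ : (Σ k, (Fin m → Fin (2 ^ k))) → Fin m → Measure ℝ := fun v j =>
    if ν (R v j) = 0 then ν else ν[|R v j]
  have hθ : ∀ v j, IsProbabilityMeasure (θ v j) := by
    intro v j
    simp only [θ]
    split_ifs with h
    exacts [inferInstance, cond_isProbabilityMeasure h]
  have hθR : ∀ v j A, ν (R v j ∩ A) = ν (R v j) * θ v j A := by
    intro v j A
    simp only [θ]
    split_ifs with h
    · rw [h, zero_mul]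
      exact measure_mono_null Set.inter_subset_left h
    · rw [cond_apply (hR v j), ← mul_assoc, ENNReal.mul_inv_cancel h (measure_ne_top _ _), one_mul]
  have hdens : ∀ x, ENNReal.ofReal (φ x) =
      ∑' v, (Set.univ.pi (R v)).indicator (fun _ => ENNReal.ofReal (a v.1 v.2)) x := by
    intro x
    rw [ENNReal.tsum_sigma', ← (hsum x).tsum_eq,
      ENNReal.ofReal_tsum_of_nonneg (fun k => ha0 _ _) (hsum x).summable]
    refine tsum_congr fun k => ?_
    rw [tsum_fintype, Finset.sum_eq_single fun j => dyadicCell k (x j)]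
    · rw [Set.indicator_of_mem]
      simp [R]
    · intro Q _ hQ
      refine Set.indicator_of_notMem (fun h => hQ ?_) _
      ext1 j
      simpa [R] using (h j (Set.mem_univ j)).symm
    · simp
  have hrect : ∀ A : Fin m → Set ℝ, (∀ j, MeasurableSet (A j)) →
      μ (Set.univ.pi A) = ∑' v, w v * ∏ j, θ v j (A j) := by
    intro A hA
    rw [hμ, withDensity_apply _ (MeasurableSet.univ_pi hA)]
    simp only [hdens]
    rw [lintegral_tsum fun v =>
      (measurable_const.indicator (MeasurableSet.univ_pi (hR v))).aemeasurable]
    refine tsum_congr fun v => ?_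
    rw [lintegral_indicator_const (MeasurableSet.univ_pi (hR v)),
      Measure.restrict_apply (MeasurableSet.univ_pi (hR v)), ← Set.pi_inter_distrib,
      Measure.pi_pi]
    simp only [w, hθR, Finset.prod_mul_distrib, R]
    rw [mul_assoc]
  have hw1 : ∑' v, w v = 1 := by
    have := hrect (fun _ => Set.univ) fun _ => MeasurableSet.univ
    simpa using this.symm
  have : Infinite (Σ k, (Fin m → Fin (2 ^ k))) :=
    Infinite.of_injective (fun k => ⟨k, fun _ => 0⟩) fun k l h => congrArg Sigma.fst h
  obtain ⟨e⟩ : Nonempty (ℕ ≃ Σ k, (Fin m → Fin (2 ^ k))) :=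
    nonempty_equiv_of_countable
  let ρ : Measure ℕ := Measure.sum fun n => w (e n) • Measure.dirac n
  have hρ : ∀ n, ρ {n} = w (e n) := by
    intro n
    rw [Measure.sum_apply _ (measurableSet_singleton _), tsum_eq_single n]
    · simp
    · intro k hk
      simp [hk]
  refine ⟨ρ, fun n => θ (e n), ⟨?_⟩, fun n j => hθ _ _, ?_, fun A hA => ?_⟩
  · rw [Measure.sum_apply _ MeasurableSet.univ]
    simpa using (e.tsum_eq w).trans hw1
  · have hwr : ∀ v, (w v).toReal = a v.1 v.2 * ∏ j, ν.real (dyadicCell v.1 ⁻¹' {v.2 j}) := by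
      intro v
      simp [w, ENNReal.toReal_mul, ENNReal.toReal_ofReal (ha0 _ _), ENNReal.toReal_prod,
        measureReal_def]
    have hw : ∀ v, (w v).toReal ≤ 1 := fun v =>
      ENNReal.toReal_le_of_le_ofReal zero_le_one (by simpa [hw1] using ENNReal.le_tsum (f := w) v)
    simp only [hwr] at hw
    have h := (summable_negMulLog_dyadic hC ha0 haC fun k Q => hw ⟨k, Q⟩).comp_injective e.injective
    simpa only [hρ, hwr, Function.comp_def] using h
  · rw [hrect A hA, ← e.tsum_eq]
    simp only [hρ]

end Mixture

section GaussianDensity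

open Real

theorem MeasureTheory.Measure.pi_withDensity_ofReal {ι : Type*} [Fintype ι] {μ : Measure ℝ}
    [SigmaFinite μ] {f : ι → ℝ → ℝ} (hf : ∀ i x, 0 ≤ f i x) (hfi : ∀ i, Integrable (f i) μ) :
    Measure.pi (fun i => μ.withDensity fun x => ENNReal.ofReal (f i x)) =
      (Measure.pi fun _ : ι => μ).withDensity fun x => ENNReal.ofReal (∏ i, f i (x i)) := by
  have : ∀ i, IsFiniteMeasure (μ.withDensity fun x => ENNReal.ofReal (f i x)) := fun i =>
    isFiniteMeasure_withDensity_ofReal (hfi i).2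
  refine Measure.pi_eq fun s hs => ?_
  rw [withDensity_apply _ (MeasurableSet.univ_pi hs),
    ← lintegral_indicator (MeasurableSet.univ_pi hs)]
  have h1 : ∀ x : ι → ℝ, (Set.univ.pi s).indicator (fun x => ENNReal.ofReal (∏ i, f i (x i))) x =
      ENNReal.ofReal (∏ i, (s i).indicator (f i) (x i)) := by
    intro x
    by_cases hx : x ∈ Set.univ.pi s
    · rw [Set.indicator_of_mem hx]
      congr 1
      exact Finset.prod_congr rfl fun i _ => (Set.indicator_of_mem (hx i (Set.mem_univ i)) _).symm
    · rw [Set.indicator_of_notMem hx]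
      simp only [Set.mem_pi, Set.mem_univ, true_imp_iff, not_forall] at hx
      obtain ⟨i, hi⟩ := hx
      rw [Finset.prod_eq_zero (Finset.mem_univ i) (Set.indicator_of_notMem hi _),
          ENNReal.ofReal_zero]
  have hi : ∀ i, Integrable ((s i).indicator (f i)) μ := fun i => (hfi i).indicator (hs i)
  have h0 : ∀ i x, 0 ≤ (s i).indicator (f i) x := fun i x =>
    Set.indicator_nonneg (fun x _ => hf i x) x
  simp only [h1]
  rw [← ofReal_integral_eq_lintegral_ofReal (Integrable.fintype_prod fun i => hi i)
    (ae_of_all _ fun x => Finset.prod_nonneg fun i _ => h0 i _), integral_fintype_prod_eq_prod,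
    ENNReal.ofReal_prod_of_nonneg fun i _ => integral_nonneg (h0 i)]
  refine Finset.prod_congr rfl fun i _ => ?_
  rw [ofReal_integral_eq_lintegral_ofReal (hi i) (ae_of_all _ (h0 i)), withDensity_apply _ (hs i),
    ← lintegral_indicator (hs i)]
  congr 1 with x
  by_cases hx : x ∈ s i <;> simp [hx]

theorem abs_exp_neg_sub_le {m : ℕ} (A : Matrix (Fin m) (Fin m) ℝ) {δ : ℝ} (hδ : 0 < δ)
    (hA : ∀ x, δ * (x ⬝ᵥ x) ≤ x ⬝ᵥ A *ᵥ x) (x y : Fin m → ℝ) (D : ℝ)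
    (hD : ∀ j, |arctan (x j) - arctan (y j)| ≤ D) :
    |exp (-(x ⬝ᵥ A *ᵥ x)) - exp (-(y ⬝ᵥ A *ᵥ y))| ≤
      2 * (∑ i, ∑ j, |A i j|) * (max 1 (2 / δ)) ^ 2 * D := by
  let θ : Fin m → ℝ → ℝ := fun j s => arctan (y j) + s * (arctan (x j) - arctan (y j))
  let z : ℝ → Fin m → ℝ := fun s j => tan (θ j s)
  have hθ : ∀ j, ∀ s ∈ Set.Icc (0 : ℝ) 1, θ j s ∈ Set.Ioo (-(π / 2)) (π / 2) := by
    intro j s hs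
    have := (convex_Ioo (-(π / 2)) (π / 2)).add_smul_sub_mem (arctan_mem_Ioo (y j))
      (arctan_mem_Ioo (x j)) hs
    simpa using this
  let z' : ℝ → Fin m → ℝ := fun s j => (1 + z s j ^ 2) * (arctan (x j) - arctan (y j))
  have hz : ∀ s ∈ Set.Icc (0 : ℝ) 1, ∀ j, HasDerivAt (fun s => z s j) (z' s j) s := by
    intro s hs j
    have h1 := hasDerivAt_tan_of_mem_Ioo (hθ j s hs)
    have h2 : HasDerivAt (θ j) (arctan (x j) - arctan (y j)) s :=
      (hasDerivAt_mul_const _).const_add _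
    rw [one_div, ← inv_one_add_tan_sq (cos_pos_of_mem_Ioo (hθ j s hs)).ne', inv_inv] at h1
    exact h1.comp s h2
  have hq : ∀ x : Fin m → ℝ, x ⬝ᵥ A *ᵥ x = ∑ i, ∑ j, A i j * (x i * x j) := by
    intro x
    simp only [dotProduct, mulVec, Finset.mul_sum]
    exact Finset.sum_congr rfl fun i _ => Finset.sum_congr rfl fun j _ => by ring
  let q' : ℝ → ℝ := fun s => ∑ i, ∑ j, A i j * (z' s i * z s j + z s i * z' s j)
  have hh : ∀ s ∈ Set.Icc (0 : ℝ) 1, HasDerivWithinAt (fun s => exp (-(z s ⬝ᵥ A *ᵥ z s)))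
      (exp (-(z s ⬝ᵥ A *ᵥ z s)) * -q' s) (Set.Icc 0 1) s := by
    intro s hs
    have h : HasDerivAt (fun s => z s ⬝ᵥ A *ᵥ z s) (q' s) s := by
      simp only [hq]
      exact HasDerivAt.fun_sum fun i _ => HasDerivAt.fun_sum fun j _ =>
        ((hz s hs i).mul (hz s hs j)).const_mul _
    exact h.neg.exp.hasDerivWithinAt
  have hzsq : ∀ s j, z s j ^ 2 ≤ z s ⬝ᵥ z s := by
    intro s j
    rw [sq]
    exact Finset.single_le_sum (f := fun j => z s j * z s j) (fun i _ => mul_self_nonneg _)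
      (Finset.mem_univ j)
  have hz1 : ∀ s i j, |z' s i * z s j| ≤ D * (1 + z s ⬝ᵥ z s) ^ 2 := by
    intro s i j
    have h0 : 0 ≤ z s ⬝ᵥ z s := (sq_nonneg _).trans (hzsq s i)
    have h1 : |z s j| ≤ 1 + z s ⬝ᵥ z s := by
      have := hzsq s j
      rw [← sq_abs] at this
      nlinarith [sq_nonneg (|z s j| - 1)]
    have h2 : |1 + z s i ^ 2| ≤ 1 + z s ⬝ᵥ z s := by
      rw [abs_of_nonneg (by positivity)]
      linarith [hzsq s i]
    have h3 := hD i
    have h4 := (abs_nonneg _).trans h3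
    rw [abs_mul, abs_mul]
    calc _ ≤ (1 + z s ⬝ᵥ z s) * D * (1 + z s ⬝ᵥ z s) := by gcongr
      _ = _ := by ring
  have hq' : ∀ s, |q' s| ≤ (∑ i, ∑ j, |A i j|) * (2 * (D * (1 + z s ⬝ᵥ z s) ^ 2)) := by
    intro s
    simp only [Finset.sum_mul]
    refine (Finset.abs_sum_le_sum_abs _ _).trans (Finset.sum_le_sum fun i _ =>
      (Finset.abs_sum_le_sum_abs _ _).trans (Finset.sum_le_sum fun j _ => ?_))
    rw [abs_mul]
    refine mul_le_mul_of_nonneg_left ?_ (abs_nonneg _)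
    have h1 := hz1 s i j
    have h2 := hz1 s j i
    rw [mul_comm] at h2
    linarith [abs_add_le (z' s i * z s j) (z s i * z' s j)]
  have hexp : ∀ t, 0 ≤ t → exp (-(δ * t)) * (1 + t) ^ 2 ≤ (max 1 (2 / δ)) ^ 2 := by
    intro t ht
    have h1 : 1 + t ≤ max 1 (2 / δ) * exp (δ * t / 2) := by
      have h2 : t ≤ max 1 (2 / δ) * (δ * t / 2) := by
        calc t = 2 / δ * (δ * t / 2) := by field_simp
          _ ≤ _ := by gcongr; exact le_max_right _ _
      calc 1 + t ≤ max 1 (2 / δ) * (1 + δ * t / 2) := by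
            rw [mul_add, mul_one]
            gcongr
            exact le_max_left _ _
        _ ≤ _ := by
            gcongr
            linarith [add_one_le_exp (δ * t / 2)]
    have h3 : exp (δ * t / 2) ^ 2 = exp (δ * t) := by
      rw [← exp_nat_mul]
      congr 1
      push_cast
      ring
    calc _ ≤ exp (-(δ * t)) * (max 1 (2 / δ) * exp (δ * t / 2)) ^ 2 := by gcongr
      _ = max 1 (2 / δ) ^ 2 * (exp (-(δ * t)) * exp (δ * t)) := by rw [mul_pow, h3]; ring
      _ = _ := by rw [← Real.exp_add]; simp
  have hbound : ∀ s ∈ Set.Ico (0 : ℝ) 1, ‖exp (-(z s ⬝ᵥ A *ᵥ z s)) * -q' s‖ ≤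
      2 * (∑ i, ∑ j, |A i j|) * (max 1 (2 / δ)) ^ 2 * D := by
    intro s _
    rcases isEmpty_or_nonempty (Fin m) with hm | ⟨⟨j⟩⟩
    · simp [q']
    have h0 : 0 ≤ z s ⬝ᵥ z s := (sq_nonneg _).trans (hzsq s j)
    have hD0 := (abs_nonneg _).trans (hD j)
    rw [norm_mul, norm_neg, norm_of_nonneg (exp_pos _).le, norm_eq_abs]
    calc _ ≤ exp (-(δ * (z s ⬝ᵥ z s))) *
          ((∑ i, ∑ j, |A i j|) * (2 * (D * (1 + z s ⬝ᵥ z s) ^ 2))) := by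
          gcongr
          exacts [hA _, hq' s]
      _ = (2 * (∑ i, ∑ j, |A i j|) * D) *
          (exp (-(δ * (z s ⬝ᵥ z s))) * (1 + z s ⬝ᵥ z s) ^ 2) := by ring
      _ ≤ (2 * (∑ i, ∑ j, |A i j|) * D) * (max 1 (2 / δ)) ^ 2 := by
          gcongr
          exact hexp _ h0
      _ = _ := by ring
  have h := norm_image_sub_le_of_norm_deriv_le_segment_01' hh hbound
  have h1 : z 1 = x := by
    ext j
    simp [z, θ, tan_arctan]
  have h0 : z 0 = y := by
    ext j
    simp [z, θ, tan_arctan]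
  rwa [h1, h0] at h

theorem prod_gaussianPDFReal_zero {m : ℕ} (v : NNReal) (x : Fin m → ℝ) :
    ∏ j, gaussianPDFReal 0 v (x j) = (√(2 * π * v))⁻¹ ^ m * exp (-(x ⬝ᵥ x / (2 * v))) := by
  simp only [gaussianPDFReal, Finset.prod_mul_distrib, Finset.prod_const, Finset.card_univ,
    Fintype.card_fin, ← Real.exp_sum, sub_zero, dotProduct, Finset.sum_div,
    ← Finset.sum_neg_distrib]
  congr 3 with j
  ring

theorem dotProduct_mulVec_self_le {m : ℕ} (L : Matrix (Fin m) (Fin m) ℝ) (x : Fin m → ℝ) :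
    (L *ᵥ x) ⬝ᵥ (L *ᵥ x) ≤ (∑ i, ∑ j, L i j ^ 2) * (x ⬝ᵥ x) := by
  rw [dotProduct, Finset.sum_mul]
  refine Finset.sum_le_sum fun i _ => ?_
  rw [← sq]
  have h := Finset.sum_mul_sq_le_sq_mul_sq Finset.univ (L i) x
  simpa [mulVec, dotProduct, sq] using h

/-- A nondegenerate Gaussian measure is a mixture of product measures, with mixing weights of
finite entropy. -/
theorem exists_gaussian_mixture {m : ℕ} {L : Matrix (Fin m) (Fin m) ℝ} (hL : IsUnit L.det) :
    ∃ (ρ : Measure ℕ) (κ : ℕ → Fin m → Measure ℝ), IsProbabilityMeasure ρ ∧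
      (∀ n j, IsProbabilityMeasure (κ n j)) ∧
      (Summable fun n => negMulLog (ρ {n}).toReal) ∧
      ∀ A : Fin m → Set ℝ, (∀ j, MeasurableSet (A j)) →
        (Measure.pi fun _ => gaussianReal 0 1).map (fun x => L *ᵥ x) (Set.univ.pi A) =
          ∑' n, ρ {n} * ∏ j, κ n j (A j) := by
  have hmeas : ∀ M : Matrix (Fin m) (Fin m) ℝ, Measurable fun x => M *ᵥ x := fun M =>
    (Continuous.matrix_mulVec continuous_const continuous_id).measurable
  have : IsProbabilityMeasure ((Measure.pi fun _ : Fin m => gaussianReal 0 1).map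
      (fun x => L *ᵥ x)) := Measure.isProbabilityMeasure_map (hmeas L).aemeasurable
  let C : NNReal := ⟨1 + ∑ i, ∑ j, L i j ^ 2, by positivity⟩
  have hC : 0 < (C : ℝ) := by
    change 0 < 1 + ∑ i, ∑ j, L i j ^ 2
    positivity
  have hCL : ∀ x, x ⬝ᵥ x ≤ C * ((L⁻¹ *ᵥ x) ⬝ᵥ (L⁻¹ *ᵥ x)) := by
    intro x
    have h := dotProduct_mulVec_self_le L (L⁻¹ *ᵥ x)
    rw [mulVec_mulVec, mul_nonsing_inv _ hL, one_mulVec] at h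
    have h0 : 0 ≤ (L⁻¹ *ᵥ x) ⬝ᵥ (L⁻¹ *ᵥ x) := Finset.sum_nonneg fun i _ => mul_self_nonneg _
    change _ ≤ (1 + ∑ i, ∑ j, L i j ^ 2) * _
    linarith
  let v : NNReal := 2 * C
  have hv : (v : ℝ) = 2 * C := rfl
  have hv0 : v ≠ 0 := by
    rw [← NNReal.coe_ne_zero, hv]
    positivity
  let A : Matrix (Fin m) (Fin m) ℝ := (1 / 2 : ℝ) • ((L⁻¹)ᵀ * L⁻¹ - (v : ℝ)⁻¹ • 1)
  have hAq : ∀ x, x ⬝ᵥ A *ᵥ x =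
      ((L⁻¹ *ᵥ x) ⬝ᵥ (L⁻¹ *ᵥ x)) / 2 - x ⬝ᵥ x / (2 * v) := by
    intro x
    have h : x ⬝ᵥ (L⁻¹)ᵀ *ᵥ L⁻¹ *ᵥ x = (L⁻¹ *ᵥ x) ⬝ᵥ (L⁻¹ *ᵥ x) := by
      rw [dotProduct_mulVec, vecMul_transpose]
    simp only [A, smul_mulVec, sub_mulVec, dotProduct_smul, dotProduct_sub, one_mulVec,
      ← mulVec_mulVec, h, smul_eq_mul]
    ring
  have hA : ∀ x, (4 * C : ℝ)⁻¹ * (x ⬝ᵥ x) ≤ x ⬝ᵥ A *ᵥ x := by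
    intro x
    rw [hAq, hv]
    have := hCL x
    field_simp
    linarith
  let c : ℝ := |(L.det)⁻¹| * ((√(2 * π * (1 : NNReal)))⁻¹ ^ m / (√(2 * π * v))⁻¹ ^ m)
  have hc : 0 ≤ c := by positivity
  have hdens : (Measure.pi fun _ : Fin m => gaussianReal 0 1).map (fun x => L *ᵥ x) =
      (Measure.pi fun _ => gaussianReal 0 v).withDensity
        fun x => ENNReal.ofReal (c * exp (-(x ⬝ᵥ A *ᵥ x))) := by
    have hpi : ∀ w : NNReal, w ≠ 0 → (Measure.pi fun _ : Fin m => gaussianReal 0 w) =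
        volume.withDensity fun x => ENNReal.ofReal (∏ j, gaussianPDFReal 0 w (x j)) := by
      intro w hw
      rw [gaussianReal_of_var_ne_zero _ hw, gaussianPDF_def, volume_pi,
        Measure.pi_withDensity_ofReal (fun _ => gaussianPDFReal_nonneg 0 w)
          fun _ => integrable_gaussianPDFReal 0 w]
    have hg : ∀ w : NNReal, Measurable fun x : Fin m → ℝ =>
        ENNReal.ofReal (∏ j, gaussianPDFReal 0 w (x j)) := by
      intro w
      have := measurable_gaussianPDFReal 0 w
      fun_prop
    rw [hpi 1 one_ne_zero, hpi v hv0, ← withDensity_mul _ (hg v)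
      (by have := hmeas A; unfold dotProduct; fun_prop)]
    have hg1 : Measurable fun x : Fin m → ℝ =>
        ENNReal.ofReal (∏ j, gaussianPDFReal 0 1 ((L⁻¹ *ᵥ x) j)) := (hg 1).comp (hmeas _)
    ext s hs
    rw [Measure.map_apply (hmeas L) hs, withDensity_apply _ ((hmeas L) hs),
      withDensity_apply _ hs]
    have hmap := map_matrix_volume_pi_eq_smul_volume_pi hL.ne_zero
    have hLx : ∀ x, x = L⁻¹ *ᵥ L *ᵥ x := fun x => by
      rw [mulVec_mulVec, nonsing_inv_mul _ hL, one_mulVec]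
    calc _ = ∫⁻ x in (fun x => L *ᵥ x) ⁻¹' s,
          ENNReal.ofReal (∏ j, gaussianPDFReal 0 1 ((L⁻¹ *ᵥ (L *ᵥ x)) j)) := by
          simp only [← hLx]
      _ = ∫⁻ x in s, ENNReal.ofReal (∏ j, gaussianPDFReal 0 1 ((L⁻¹ *ᵥ x) j))
          ∂(volume.map (fun x => L *ᵥ x)) := by
          rw [setLIntegral_map hs hg1 (hmeas L)]
      _ = ENNReal.ofReal |(L.det)⁻¹| *
          ∫⁻ x in s, ENNReal.ofReal (∏ j, gaussianPDFReal 0 1 ((L⁻¹ *ᵥ x) j)) := by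
          change ∫⁻ x in s, _ ∂(volume.map (toLin' L)) = _
          rw [hmap, Measure.restrict_smul, lintegral_smul_measure, smul_eq_mul]
      _ = _ := by
          rw [← lintegral_const_mul _ hg1]
          refine lintegral_congr fun x => ?_
          simp only [Pi.mul_apply]
          rw [← ENNReal.ofReal_mul (abs_nonneg _), ← ENNReal.ofReal_mul
            (Finset.prod_nonneg fun i _ => gaussianPDFReal_nonneg 0 v _),
            prod_gaussianPDFReal_zero, prod_gaussianPDFReal_zero, hAq]
          congr 1
          have h2 : (√(2 * π * v))⁻¹ ^ m ≠ 0 := by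
            have : 0 < (v : ℝ) := by rw [hv]; positivity
            positivity
          have h3 : exp (-(L⁻¹ *ᵥ x ⬝ᵥ L⁻¹ *ᵥ x / (2 * (1 : NNReal)))) =
              exp (-(x ⬝ᵥ x / (2 * v))) *
                exp (-((L⁻¹ *ᵥ x) ⬝ᵥ (L⁻¹ *ᵥ x) / 2 - x ⬝ᵥ x / (2 * v))) := by
            rw [← Real.exp_add]
            congr 1
            push_cast
            ring
          rw [h3]
          simp only [c]
          field_simp
  have hA0 : ∀ x, exp (-(x ⬝ᵥ A *ᵥ x)) ≤ 1 := fun x => by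
    rw [exp_le_one_iff, neg_nonpos]
    refine le_trans ?_ (hA x)
    exact mul_nonneg (by positivity) (Finset.sum_nonneg fun i _ => mul_self_nonneg _)
  let B : ℝ := 2 * (∑ i, ∑ j, |A i j|) * (max 1 (2 / (4 * C : ℝ)⁻¹)) ^ 2
  have hB : 0 ≤ B := by positivity
  refine exists_discrete_product_mixture (B := c * (1 + B)) hdens (fun x => by positivity)
    (fun x => ?_) (fun x y D hD0 hD => ?_)
  · exact mul_le_mul_of_nonneg_left ((hA0 x).trans (by linarith)) hc
  · rw [← mul_sub, abs_mul, abs_of_nonneg hc, mul_assoc c]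
    refine mul_le_mul_of_nonneg_left ?_ hc
    have := abs_exp_neg_sub_le A (by positivity) hA x y D hD
    linarith

end GaussianDensity

section GaussianVectors

variable {Ω : Type*} [MeasurableSpace Ω] {P : Measure Ω} {ι : Type*} [Fintype ι]

theorem Measure.map_eq_of_map_dotProduct_eq {Ω' : Type*} [MeasurableSpace Ω'] {P' : Measure Ω'}
    [IsProbabilityMeasure P] [IsProbabilityMeasure P'] {Z : Ω → ι → ℝ} {Z' : Ω' → ι → ℝ}
    (hZ : Measurable Z) (hZ' : Measurable Z')
    (h : ∀ a : ι → ℝ, P'.map (fun ω => a ⬝ᵥ Z' ω) = P.map (fun ω => a ⬝ᵥ Z ω)) :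
    P'.map Z' = P.map Z := by
  classical
  have := Measure.isProbabilityMeasure_map (μ := P) hZ.aemeasurable
  have := Measure.isProbabilityMeasure_map (μ := P') hZ'.aemeasurable
  refine Measure.ext_of_charFunDual ?_
  ext L
  have hL : ∀ x : ι → ℝ, L x = (fun i => L (Pi.single i 1)) ⬝ᵥ x := fun x => by
    conv_lhs => rw [pi_eq_sum_univ' x, map_sum]
    simp [dotProduct, mul_comm]
  rw [charFunDual_eq_charFun_map_one, charFunDual_eq_charFun_map_one,
    Measure.map_map L.continuous.measurable hZ, Measure.map_map L.continuous.measurable hZ']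
  have h1 : (⇑L ∘ Z) = fun ω => (fun i => L (Pi.single i 1)) ⬝ᵥ Z ω := funext fun ω => hL _
  have h2 : (⇑L ∘ Z') = fun ω => (fun i => L (Pi.single i 1)) ⬝ᵥ Z' ω := funext fun ω => hL _
  rw [h1, h2, h]

theorem IsGaussianVec.hasGaussianLaw {Z : Ω → ι → ℝ} (hZ : Measurable Z) (h : IsGaussianVec P Z) :
    HasGaussianLaw Z P := by
  classical
  refine ⟨isGaussian_of_map_eq_gaussianReal fun L => ?_⟩
  obtain ⟨m, v, hmv⟩ := h fun i => L (Pi.single i 1)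
  refine ⟨m, v, ?_⟩
  rw [← hmv, Measure.map_map L.continuous.measurable hZ]
  congr 1 with ω
  simp only [Function.comp_apply]
  conv_lhs => rw [pi_eq_sum_univ' (Z ω), map_sum]
  simp [mul_comm]

theorem ProbabilityTheory.HasGaussianLaw.dotProduct {Z : Ω → ι → ℝ} (h : HasGaussianLaw Z P)
    (a : ι → ℝ) : HasGaussianLaw (fun ω => a ⬝ᵥ Z ω) P :=
  h.map_fun (∑ i, a i • ContinuousLinearMap.proj i : (ι → ℝ) →L[ℝ] ℝ) |>.congr
    (ae_of_all _ fun ω => by simp [_root_.dotProduct])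

theorem integral_dotProduct_mul_dotProduct {Z : Ω → ι → ℝ} (h : HasGaussianLaw Z P)
    {K : Matrix ι ι ℝ} (hK : ∀ p q, K p q = ∫ ω, Z ω p * Z ω q ∂P) (a b : ι → ℝ) :
    ∫ ω, (a ⬝ᵥ Z ω) * (b ⬝ᵥ Z ω) ∂P = a ⬝ᵥ K *ᵥ b := by
  have hi : ∀ p q, Integrable (fun ω => a p * Z ω p * (b q * Z ω q)) P := fun p q =>
    ((h.eval p).memLp_two.const_mul _).integrable_mul ((h.eval q).memLp_two.const_mul _)
  simp only [dotProduct, Finset.sum_mul_sum, mulVec]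
  rw [integral_finsetSum _ fun p _ => integrable_finsetSum _ fun q _ => hi p q]
  refine Finset.sum_congr rfl fun p _ => ?_
  rw [integral_finsetSum _ fun q _ => hi p q, Finset.mul_sum]
  refine Finset.sum_congr rfl fun q _ => ?_
  rw [hK, ← integral_mul_const, ← integral_const_mul]
  congr 1 with ω
  ring

theorem integral_dotProduct_eq_zero {Z : Ω → ι → ℝ} (h : HasGaussianLaw Z P)
    (h0 : ∀ p, ∫ ω, Z ω p ∂P = 0) (a : ι → ℝ) : ∫ ω, a ⬝ᵥ Z ω ∂P = 0 := by
  simp only [dotProduct]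
  rw [integral_finsetSum _ fun p _ => (h.eval p).integrable.const_mul _]
  simp [integral_const_mul, h0]

theorem map_dotProduct_eq_gaussianReal {Z : Ω → ι → ℝ} (h : HasGaussianLaw Z P)
    (h0 : ∀ p, ∫ ω, Z ω p ∂P = 0)
    {K : Matrix ι ι ℝ} (hK : ∀ p q, K p q = ∫ ω, Z ω p * Z ω q ∂P) (a : ι → ℝ) :
    P.map (fun ω => a ⬝ᵥ Z ω) = gaussianReal 0 (a ⬝ᵥ K *ᵥ a).toNNReal := by
  have := h.isProbabilityMeasure
  have hm := integral_dotProduct_eq_zero h h0 a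
  rw [(h.dotProduct a).map_eq_gaussianReal, hm, variance_of_integral_eq_zero
    (h.dotProduct a).aemeasurable hm, ← integral_dotProduct_mul_dotProduct h hK]
  simp [sq]

theorem map_dotProduct_pi_gaussianReal (a : ι → ℝ) :
    (Measure.pi fun _ : ι => gaussianReal 0 1).map (fun x => a ⬝ᵥ x) =
      gaussianReal 0 (a ⬝ᵥ a).toNNReal := by
  classical
  have hlaw : ∀ i, HasGaussianLaw (fun x : ι → ℝ => x i)
      (Measure.pi fun _ : ι => gaussianReal 0 1) := fun i => by
    refine ⟨?_⟩
    rw [(measurePreserving_eval (fun _ : ι => gaussianReal 0 1) i).map_eq]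
    infer_instance
  have hG : HasGaussianLaw (fun x : ι → ℝ => x) (Measure.pi fun _ : ι => gaussianReal 0 1) :=
    (iIndepFun_pi (X := fun _ => id) fun _ => aemeasurable_id).hasGaussianLaw hlaw
  have heval : ∀ p, ∀ f : ℝ → ℝ, Measurable f →
      ∫ x : ι → ℝ, f (x p) ∂(Measure.pi fun _ : ι => gaussianReal 0 1) =
        ∫ y, f y ∂(gaussianReal 0 1) := fun p f hf => by
    conv_rhs => rw [← (measurePreserving_eval (fun _ : ι => gaussianReal 0 1) p).map_eq]
    exact (integral_map (measurable_pi_apply p).aemeasurable hf.aestronglyMeasurable).symm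
  have h0 : ∀ p, ∫ x : ι → ℝ, x p ∂(Measure.pi fun _ : ι => gaussianReal 0 1) = 0 := fun p => by
    rw [heval p (fun y => y) measurable_id]
    exact integral_id_gaussianReal
  have hK : ∀ p q, (1 : Matrix ι ι ℝ) p q =
      ∫ x : ι → ℝ, x p * x q ∂(Measure.pi fun _ : ι => gaussianReal 0 1) := by
    intro p q
    rcases eq_or_ne p q with rfl | hpq
    · rw [heval p (fun y => y * y) (by fun_prop), one_apply_eq]
      have := variance_of_integral_eq_zero (μ := gaussianReal 0 1) (X := id) (by fun_prop)
        integral_id_gaussianReal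
      rw [variance_id_gaussianReal] at this
      simpa [sq] using this
    · rw [one_apply_ne hpq]
      have := (((iIndepFun_pi (μ := fun _ : ι => gaussianReal 0 1) (X := fun _ => id)
        fun _ => aemeasurable_id).indepFun hpq).integral_fun_mul_eq_mul_integral
          (measurable_pi_apply p).aestronglyMeasurable (measurable_pi_apply q).aestronglyMeasurable)
      simp only [id] at this
      rw [this, h0, zero_mul]
  simpa using map_dotProduct_eq_gaussianReal hG h0 hK a

end GaussianVectors

section Achievability

theorem exists_eq_mul_transpose_of_posDef {m : ℕ} {Γ : Matrix (Fin m) (Fin m) ℝ}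
    (hΓ : Γ.PosDef) : ∃ L : Matrix (Fin m) (Fin m) ℝ, IsUnit L.det ∧ Γ = L * Lᵀ := by
  open scoped MatrixOrder in
  obtain ⟨L, hL⟩ := CStarAlgebra.nonneg_iff_eq_mul_star_self.mp hΓ.posSemidef.nonneg
  rw [star_eq_conjTranspose, conjTranspose_eq_transpose_of_trivial] at hL
  refine ⟨L, isUnit_iff_ne_zero.2 fun h => hΓ.det_pos.ne' ?_, hL⟩
  rw [hL, det_mul, h, zero_mul]

theorem measure_pi_inter_of_dependsOn {J : Type*} [Fintype J] {ν : J → Measure ℝ}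
    [∀ j, IsProbabilityMeasure (ν j)] {s t : Finset J} (hst : Disjoint s t)
    {S T : Set (J → ℝ)} (hS : MeasurableSet S) (hT : MeasurableSet T)
    (hSs : DependsOn (· ∈ S) (s : Set J)) (hTt : DependsOn (· ∈ T) (t : Set J)) :
    Measure.pi ν (S ∩ T) = Measure.pi ν S * Measure.pi ν T := by
  classical
  let ext : ∀ u : Finset J, (u → ℝ) → J → ℝ := fun u y j => if h : j ∈ u then y ⟨j, h⟩ else 0
  have hext : ∀ u, Measurable (ext u) := fun u => measurable_pi_lambda _ fun j => by
    by_cases h : j ∈ u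
    · simpa [ext, h] using measurable_pi_apply _
    · simp [ext, h]
  have hpre : ∀ (u : Finset J) (U : Set (J → ℝ)), DependsOn (· ∈ U) (u : Set J) →
      U = (fun (y : J → ℝ) (j : u) => y j) ⁻¹' (ext u ⁻¹' U) := fun u U hU => by
    ext y
    exact iff_of_eq (hU fun j hj => by simp [ext, Finset.mem_coe.1 hj])
  have hind := (iIndepFun_pi (μ := ν) (X := fun _ => id) fun _ => aemeasurable_id).indepFun_finset
    s t hst fun j => measurable_pi_apply j
  rw [hpre s S hSs, hpre t T hTt]
  exact hind.measure_inter_preimage_eq_mul _ _ (hext s hS) (hext t hT)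

theorem measure_pi_iInter_of_dependsOn {J β : Type*} [Fintype J] [Fintype β] {ν : J → Measure ℝ}
    [∀ j, IsProbabilityMeasure (ν j)] (c : J → β) {T : β → Set (J → ℝ)}
    (hT : ∀ i, MeasurableSet (T i)) (hdep : ∀ i, DependsOn (· ∈ T i) {j | c j = i}) :
    Measure.pi ν (⋂ i, T i) = ∏ i, Measure.pi ν (T i) := by
  classical
  suffices h : ∀ s : Finset β, Measure.pi ν (⋂ i ∈ s, T i) = ∏ i ∈ s, Measure.pi ν (T i) by
    simpa using h Finset.univ
  intro s
  induction s using Finset.induction_on with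
  | empty => simp
  | insert i s hi ih =>
    rw [Finset.prod_insert hi, ← ih, Finset.set_biInter_insert]
    refine measure_pi_inter_of_dependsOn (s := {j | c j = i}) (t := {j | c j ∈ s})
      (Finset.disjoint_left.2 fun j => ?_) (hT i) (s.measurableSet_biInter fun i _ => hT i) ?_ ?_
    · simp only [Finset.mem_filter_univ]
      rintro rfl
      exact hi
    · simpa using hdep i
    · intro x y hxy
      simp only [Set.mem_iInter, eq_iff_iff]
      refine forall₂_congr fun l hl => iff_of_eq (hdep l fun j hj => hxy j ?_)
      simpa [show c j = l from hj] using hl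

theorem condExp_comap_fst_compProd {α β : Type*} [MeasurableSpace α] [MeasurableSpace β]
    (μ : Measure α) [IsProbabilityMeasure μ] (κ : Kernel α β) [IsMarkovKernel κ]
    {S : Set (α × β)} (hS : MeasurableSet S) :
    (μ ⊗ₘ κ)[S.indicator (fun _ => (1 : ℝ)) | MeasurableSpace.comap Prod.fst inferInstance]
      =ᵐ[μ ⊗ₘ κ] fun ω => (κ ω.1).real (Prod.mk ω.1 ⁻¹' S) := by
  have hmeas : Measurable fun a => (κ a).real (Prod.mk a ⁻¹' S) :=
    (Kernel.measurable_kernel_prodMk_left hS).ennreal_toReal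
  have hintegral : Integrable (S.indicator (fun _ => (1 : ℝ))) (μ ⊗ₘ κ) :=
    (integrable_const 1).indicator hS
  have hintegral' : Integrable (fun ω : α × β => (κ ω.1).real (Prod.mk ω.1 ⁻¹' S)) (μ ⊗ₘ κ) :=
    Integrable.of_bound (hmeas.comp measurable_fst).aestronglyMeasurable 1
      (ae_of_all _ fun ω => by simp [abs_of_nonneg measureReal_nonneg])
  symm
  refine ae_eq_condExp_of_forall_setIntegral_eq measurable_fst.comap_le hintegral
    (fun _ _ _ => hintegral'.integrableOn) ?_
    ((hmeas.comp (comap_measurable Prod.fst)).aestronglyMeasurable)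
  rintro _ ⟨s, hs, rfl⟩ -
  rw [← Set.prod_univ, Measure.setIntegral_compProd hs MeasurableSet.univ hintegral'.integrableOn,
    Measure.setIntegral_compProd hs MeasurableSet.univ hintegral.integrableOn]
  refine setIntegral_congr_fun hs fun a _ => ?_
  have : (fun b => S.indicator (fun _ => (1 : ℝ)) (a, b)) =
    (Prod.mk a ⁻¹' S).indicator fun _ => 1 := rfl
  simp [this, integral_indicator (measurable_prodMk_left hS)]

theorem measure_eq_tsum_pi_of_rectangles {J : Type*} [Fintype J] {μ : Measure (J → ℝ)}
    [IsProbabilityMeasure μ] {ρ : Measure ℕ} {κ : ℕ → J → Measure ℝ}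
    [∀ n j, IsProbabilityMeasure (κ n j)]
    (h : ∀ A : J → Set ℝ, (∀ j, MeasurableSet (A j)) →
      μ (Set.univ.pi A) = ∑' n, ρ {n} * ∏ j, κ n j (A j))
    {t : Set (J → ℝ)} (ht : MeasurableSet t) :
    μ t = ∑' n, ρ {n} * Measure.pi (κ n) t := by
  have hμ : μ = Measure.sum fun n => ρ {n} • Measure.pi (κ n) := by
    have hrect : ∀ A : J → Set ℝ, (∀ j, MeasurableSet (A j)) →
        μ (Set.univ.pi A) = (Measure.sum fun n => ρ {n} • Measure.pi (κ n)) (Set.univ.pi A) := by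
      intro A hA
      rw [h A hA, Measure.sum_apply _ (MeasurableSet.univ_pi hA)]
      simp
    refine ext_of_generate_finite _ generateFrom_pi.symm isPiSystem_pi ?_ ?_
    · rintro _ ⟨A, hA, rfl⟩
      exact hrect A fun j => hA j trivial
    · simpa using hrect (fun _ => Set.univ) fun _ => MeasurableSet.univ
  conv_lhs => rw [hμ, Measure.sum_apply _ ht]
  simp

theorem map_compProd_prodMk_eq_prod {k m : ℕ} {μ : Measure (Fin m → ℝ)} [IsProbabilityMeasure μ]
    {ρ : Measure ℕ} [IsProbabilityMeasure ρ] {γ : Measure (Fin k → ℝ)} [IsProbabilityMeasure γ]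
    {κ : ℕ → Fin m → Measure ℝ} [∀ n j, IsProbabilityMeasure (κ n j)]
    (η : Kernel (ℕ × (Fin k → ℝ)) (Fin m → ℝ)) [IsMarkovKernel η]
    (hη : ∀ x, η x = Measure.pi (κ x.1))
    (h : ∀ A : Fin m → Set ℝ, (∀ j, MeasurableSet (A j)) →
      μ (Set.univ.pi A) = ∑' n, ρ {n} * ∏ j, κ n j (A j)) :
    ((ρ.prod γ) ⊗ₘ η).map (fun ω => (ω.1.2, ω.2)) = γ.prod μ := by
  symm
  refine Measure.prod_eq fun s t hs ht => ?_
  have hpre : (fun ω : (ℕ × (Fin k → ℝ)) × (Fin m → ℝ) => (ω.1.2, ω.2)) ⁻¹' s ×ˢ t =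
      (Set.univ ×ˢ s) ×ˢ t := by
    ext; simp
  rw [Measure.map_apply (by fun_prop) (hs.prod ht), hpre,
    Measure.compProd_apply_prod (MeasurableSet.univ.prod hs) ht]
  simp only [hη]
  have hm : Measurable fun x : ℕ × (Fin k → ℝ) => Measure.pi (κ x.1) t :=
    (measurable_of_countable fun n : ℕ => Measure.pi (κ n) t).comp measurable_fst
  rw [← Measure.prod_restrict, Measure.restrict_univ, lintegral_prod _ hm.aemeasurable]
  simp only [lintegral_const, Measure.restrict_apply_univ]
  rw [lintegral_mul_const _ (measurable_of_countable _), lintegral_countable',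
    measure_eq_tsum_pi_of_rectangles h ht, mul_comm]
  simp only [mul_comm]

theorem map_dotProduct_add_prod_gaussianReal {k m : ℕ} {ι : Type*} [Fintype ι]
    (B : Matrix ι (Fin k) ℝ) (M : Matrix ι (Fin m) ℝ) (L : Matrix (Fin m) (Fin m) ℝ) (a : ι → ℝ) :
    ((Measure.pi fun _ : Fin k => gaussianReal 0 1).prod
      ((Measure.pi fun _ : Fin m => gaussianReal 0 1).map (L *ᵥ ·))).map
        (fun x => a ⬝ᵥ (B *ᵥ x.1 + M *ᵥ x.2)) =
      gaussianReal 0 (a ⬝ᵥ (B * Bᵀ + M * (L * Lᵀ) * Mᵀ) *ᵥ a).toNNReal := by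
  set γ := Measure.pi fun _ : Fin k => gaussianReal 0 1
  set ξ := Measure.pi fun _ : Fin m => gaussianReal 0 1
  have hL : Measurable fun x : Fin m → ℝ => L *ᵥ x :=
    (Continuous.matrix_mulVec continuous_const continuous_id).measurable
  have hB : Measurable fun x : (Fin k → ℝ) × (Fin m → ℝ) => a ⬝ᵥ (B *ᵥ x.1 + M *ᵥ x.2) := by
    refine Continuous.measurable ?_
    fun_prop
  have hprod : γ.prod (ξ.map (L *ᵥ ·)) = (γ.prod ξ).map (Prod.map id (L *ᵥ ·)) := by
    rw [← Measure.map_prod_map _ _ measurable_id hL, Measure.map_id]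
  have hfun : (fun x : (Fin k → ℝ) × (Fin m → ℝ) => a ⬝ᵥ (B *ᵥ x.1 + M *ᵥ x.2)) ∘
      Prod.map id (L *ᵥ ·) =
      (fun x => (a ᵥ* B) ⬝ᵥ x.1) + fun x => (a ᵥ* (M * L)) ⬝ᵥ x.2 := by
    ext x
    simp [dotProduct_add, dotProduct_mulVec, ← vecMul_vecMul]
  rw [hprod, Measure.map_map hB (by fun_prop), hfun]
  have hd : ∀ (r : ℕ) (b : Fin r → ℝ), Measurable fun x : Fin r → ℝ => b ⬝ᵥ x := fun r b =>
    (Continuous.dotProduct continuous_const continuous_id).measurable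
  have hindep : IndepFun (fun x : (Fin k → ℝ) × (Fin m → ℝ) => (a ᵥ* B) ⬝ᵥ x.1)
      (fun x => (a ᵥ* (M * L)) ⬝ᵥ x.2) (γ.prod ξ) :=
    indepFun_prod (hd _ _) (hd _ _)
  have h1 : (γ.prod ξ).map (fun x => (a ᵥ* B) ⬝ᵥ x.1) =
      gaussianReal 0 ((a ᵥ* B) ⬝ᵥ (a ᵥ* B)).toNNReal := by
    have := Measure.map_map (hd _ (a ᵥ* B)) measurable_fst (μ := γ.prod ξ)
    rw [measurePreserving_fst.map_eq, map_dotProduct_pi_gaussianReal] at this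
    exact this.symm
  have h2 : (γ.prod ξ).map (fun x => (a ᵥ* (M * L)) ⬝ᵥ x.2) =
      gaussianReal 0 ((a ᵥ* (M * L)) ⬝ᵥ (a ᵥ* (M * L))).toNNReal := by
    have := Measure.map_map (hd _ (a ᵥ* (M * L))) measurable_snd (μ := γ.prod ξ)
    rw [measurePreserving_snd.map_eq, map_dotProduct_pi_gaussianReal] at this
    exact this.symm
  have hnonneg : ∀ (r : ℕ) (b : Fin r → ℝ), 0 ≤ b ⬝ᵥ b := fun r b =>
    Finset.sum_nonneg fun i _ => mul_self_nonneg _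
  rw [gaussianReal_add_gaussianReal_of_indepFun hindep h1 h2, add_zero,
    ← Real.toNNReal_add (hnonneg _ _) (hnonneg _ _)]
  congr 2
  rw [add_mulVec, dotProduct_add, Matrix.mul_assoc, Matrix.mul_assoc, ← Matrix.mul_assoc M,
    ← transpose_mul]
  simp only [← mulVec_mulVec, dotProduct_mulVec, mulVec_transpose]
  rw [vecMul_vecMul]


theorem nonempty_simWitnessN_of_factorization {Ω : Type*} [MeasurableSpace Ω] (P : Measure Ω)
    [IsProbabilityMeasure P] {n : ℕ} {d : Fin n → ℕ} (X : ∀ i, Ω → Fin (d i) → ℝ)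
    (hX : ∀ i, Measurable (X i))
    (hGauss : IsGaussianVec P fun ω (p : (i : Fin n) × Fin (d i)) => X p.1 ω p.2)
    (hmean : ∀ i j, ∫ ω, X i ω j ∂P = 0)
    (K : Matrix ((i : Fin n) × Fin (d i)) ((i : Fin n) × Fin (d i)) ℝ)
    (hK : ∀ p q, K p q = ∫ ω, X p.1 ω p.2 * X q.1 ω q.2 ∂P) {k m : ℕ} (c : Fin m → Fin n)
    (B : Matrix ((i : Fin n) × Fin (d i)) (Fin k) ℝ)
    (M : Matrix ((i : Fin n) × Fin (d i)) (Fin m) ℝ) {Γ : Matrix (Fin m) (Fin m) ℝ}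
    (hΓ : Γ.PosDef) (hM : ∀ p j, c j ≠ p.1 → M p j = 0)
    (G : Matrix (Fin k) ((i : Fin n) × Fin (d i)) ℝ) (hGB : G * B = 1) (hGM : G * M = 0)
    (hKBM : K = B * Bᵀ + M * Γ * Mᵀ) : Nonempty (SimWitnessN P X k) := by
  obtain ⟨L, hLdet, rfl⟩ := exists_eq_mul_transpose_of_posDef hΓ
  obtain ⟨ρ, κ, hρ, hκ, hent, hmix⟩ := exists_gaussian_mixture hLdet
  set γ := Measure.pi fun _ : Fin k => gaussianReal 0 1
  set ξ := Measure.pi fun _ : Fin m => gaussianReal 0 1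
  have hL : Measurable fun x : Fin m → ℝ => L *ᵥ x :=
    (Continuous.matrix_mulVec continuous_const continuous_id).measurable
  have := Measure.isProbabilityMeasure_map (μ := ξ) hL.aemeasurable
  let η₀ : Kernel ℕ (Fin m → ℝ) := Kernel.ofFunOfCountable fun v => Measure.pi (κ v)
  have hη₀ : IsMarkovKernel η₀ := ⟨fun v => inferInstanceAs (IsProbabilityMeasure (Measure.pi _))⟩
  let η : Kernel (ℕ × (Fin k → ℝ)) (Fin m → ℝ) := η₀.comap Prod.fst measurable_fst
  have hη : ∀ x, η x = Measure.pi (κ x.1) := fun x => rfl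
  let P' := (ρ.prod γ) ⊗ₘ η
  let Z : (ℕ × (Fin k → ℝ)) × (Fin m → ℝ) → ((i : Fin n) × Fin (d i)) → ℝ := fun ω =>
    B *ᵥ ω.1.2 + M *ᵥ ω.2
  have hZ : Measurable Z := by
    refine Measurable.add ?_ ?_
    · exact (Continuous.matrix_mulVec continuous_const continuous_id).measurable.comp
        (measurable_snd.comp measurable_fst)
    · exact (Continuous.matrix_mulVec continuous_const continuous_id).measurable.comp measurable_snd
  have hXp : Measurable fun ω (p : (i : Fin n) × Fin (d i)) => X p.1 ω p.2 :=
    measurable_pi_lambda _ fun p => (measurable_pi_apply p.2).comp (hX p.1)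
  have hlaw : P'.map Z = P.map fun ω p => X p.1 ω p.2 := by
    refine Measure.map_eq_of_map_dotProduct_eq hXp hZ fun a => ?_
    rw [map_dotProduct_eq_gaussianReal (hGauss.hasGaussianLaw hXp) (fun p => hmean _ _) hK, hKBM,
      ← map_dotProduct_add_prod_gaussianReal, ← map_compProd_prodMk_eq_prod η hη hmix,
      Measure.map_map (by fun_prop) (by fun_prop)]
    rfl
  have hGZ : ∀ ω, G *ᵥ Z ω = ω.1.2 := fun ω => by
    simp [Z, mulVec_add, hGB, hGM]
  let X' : ∀ i, (ℕ × (Fin k → ℝ)) × (Fin m → ℝ) → Fin (d i) → ℝ := fun i ω j => Z ω ⟨i, j⟩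
  have hX' : ∀ i, Measurable (X' i) := fun i =>
    measurable_pi_lambda _ fun j => (measurable_pi_apply _).comp hZ
  have hcurry : Measurable fun (z : ((i : Fin n) × Fin (d i)) → ℝ) (i : Fin n) (j : Fin (d i)) =>
      z ⟨i, j⟩ := by fun_prop
  refine ⟨{ Ω' := (ℕ × (Fin k → ℝ)) × (Fin m → ℝ), P' := P', probP' := inferInstance, X' := X',
            V := fun ω => ω.1.1, G := G, measX' := hX', measV := by fun_prop, sameLaw := ?_,
            finEnt := ?_, condIndep := ?_ }⟩
  · have := congrArg (Measure.map fun (z : ((i : Fin n) × Fin (d i)) → ℝ) (i : Fin n)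
      (j : Fin (d i)) => z ⟨i, j⟩) hlaw
    rwa [Measure.map_map hcurry hZ, Measure.map_map hcurry hXp] at this
  · have hV : ∀ v, P' ((fun ω => ω.1.1) ⁻¹' {v}) = ρ {v} := fun v => by
      have : (fun ω : (ℕ × (Fin k → ℝ)) × (Fin m → ℝ) => ω.1.1) ⁻¹' {v} =
          ({v} ×ˢ Set.univ) ×ˢ Set.univ := by ext; simp
      rw [this, Measure.compProd_apply_prod (by measurability) MeasurableSet.univ]
      simp
    simpa only [HasFiniteEntropy, hV]
  · have hcomap : MeasurableSpace.comap
        (fun ω => (ω.1.1, G *ᵥ fun p : (i : Fin n) × Fin (d i) => X' p.1 ω p.2)) inferInstance =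
        MeasurableSpace.comap
          (Prod.fst : (ℕ × (Fin k → ℝ)) × (Fin m → ℝ) → ℕ × (Fin k → ℝ)) inferInstance := by
      congr 1 with ω
      · rfl
      · exact congrFun (hGZ ω) _
    intro A hA
    rw [hcomap]
    have hmem : ∀ i, MeasurableSet (X' i ⁻¹' A i) := fun i => hX' i (hA i)
    have hall := ae_all_iff.2 fun i => condExp_comap_fst_compProd (ρ.prod γ) η (hmem i)
    filter_upwards [condExp_comap_fst_compProd (ρ.prod γ) η (MeasurableSet.iInter hmem), hall]
      with ω h1 h2
    rw [h1, Finset.prod_congr rfl fun i _ => h2 i, Set.preimage_iInter, hη]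
    simp only [measureReal_def]
    rw [measure_pi_iInter_of_dependsOn c (fun i => measurable_prodMk_left (hmem i)),
      ENNReal.toReal_prod]
    intro i x y hxy
    have : X' i (ω.1, x) = X' i (ω.1, y) := by
      ext j
      simp only [X', Z, Pi.add_apply, mulVec, dotProduct]
      congr 1
      refine Finset.sum_congr rfl fun l _ => ?_
      by_cases hl : c l = i
      · rw [hxy l hl]
      · simp [hM ⟨i, j⟩ l hl]
    simp [this]

end Achievability

section Converse

variable {Ω : Type*} {m mΩ : MeasurableSpace Ω} {P : Measure Ω}

theorem condExp_indicator_inter_of_iCondIndepRV [IsProbabilityMeasure P]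
    (hm : m ≤ mΩ) {ι : Type*} [Fintype ι] {α : ι → Type*} [∀ i, MeasurableSpace (α i)]
    {X : ∀ i, Ω → α i} (hX : ∀ i, Measurable (X i)) (h : iCondIndepRV P m X) (i : ι)
    {U : Set (α i)} (hU : MeasurableSet U) {A : ∀ j, Set (α j)} (hA : ∀ j, MeasurableSet (A j))
    (hAi : A i = Set.univ) :
    P[(X i ⁻¹' U ∩ ⋂ j, X j ⁻¹' A j).indicator (fun _ => (1 : ℝ)) | m] =ᵐ[P]
      P[(⋂ j, X j ⁻¹' A j).indicator P[(X i ⁻¹' U).indicator (fun _ => (1 : ℝ)) | m] | m] := by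
  classical
  set η := P[(X i ⁻¹' U).indicator (fun _ => (1 : ℝ)) | m] with hη
  have hUint : Integrable ((X i ⁻¹' U).indicator fun _ => (1 : ℝ)) P :=
    (integrable_const 1).indicator (hX i hU)
  have hR : MeasurableSet (⋂ j, X j ⁻¹' A j) := MeasurableSet.iInter fun j => hX j (hA j)
  have hRU : X i ⁻¹' U ∩ ⋂ j, X j ⁻¹' A j = ⋂ j, X j ⁻¹' Function.update A i U j := by
    ext ω
    simp only [Set.mem_inter_iff, Set.mem_iInter, Set.mem_preimage]
    constructor
    · rintro ⟨h1, h2⟩ j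
      rcases eq_or_ne j i with rfl | hj
      · simpa using h1
      · simpa [hj] using h2 j
    · intro hω
      refine ⟨by simpa using hω i, fun j => ?_⟩
      rcases eq_or_ne j i with rfl | hj
      · simp [hAi]
      · simpa [hj] using hω j
  have hmul : (⋂ j, X j ⁻¹' A j).indicator η =
      η * (⋂ j, X j ⁻¹' A j).indicator fun _ => (1 : ℝ) := by
    ext ω
    by_cases hω : ω ∈ ⋂ j, X j ⁻¹' A j <;> simp [Set.indicator, hω]
  have hpull : P[(⋂ j, X j ⁻¹' A j).indicator η | m] =ᵐ[P]
      η * P[(⋂ j, X j ⁻¹' A j).indicator (fun _ => (1 : ℝ)) | m] := by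
    rw [hmul]
    refine condExp_mul_of_stronglyMeasurable_left stronglyMeasurable_condExp ?_
      ((integrable_const 1).indicator hR)
    rw [← hmul]
    exact integrable_condExp.indicator hR
  refine Filter.EventuallyEq.trans ?_ hpull.symm
  rw [hRU]
  have hupd : ∀ j, MeasurableSet (Function.update A i U j) := fun j => by
    rcases eq_or_ne j i with rfl | hj
    · simpa using hU
    · simpa [hj] using hA j
  filter_upwards [h _ hupd, h A hA] with ω h1 h2
  rw [h1, Pi.mul_apply, h2, ← Finset.mul_prod_erase _ _ (Finset.mem_univ i),
    ← Finset.mul_prod_erase _ _ (Finset.mem_univ i)]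
  have huniv : (X i ⁻¹' A i).indicator (fun _ => (1 : ℝ)) = fun _ => 1 := by simp [hAi]
  rw [huniv, condExp_const hm, one_mul, Function.update_self]
  congr 1
  refine Finset.prod_congr rfl fun j hj => ?_
  rw [Function.update_of_ne (Finset.ne_of_mem_erase hj)]

theorem condExp_indicator_ae_eq_of_iCondIndepRV [IsProbabilityMeasure P]
    (hm : m ≤ mΩ) {ι : Type*} [Fintype ι] {α : ι → Type*} [∀ i, MeasurableSpace (α i)]
    {X : ∀ i, Ω → α i} (hX : ∀ i, Measurable (X i)) (h : iCondIndepRV P m X) (i : ι)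
    {U : Set (α i)} (hU : MeasurableSet U) {E : Set Ω}
    (hE : MeasurableSet[m ⊔ ⨆ j, ⨆ (_ : j ≠ i), MeasurableSpace.comap (X j) inferInstance] E)
    (hUE : X i ⁻¹' U =ᵐ[P] E) :
    P[(X i ⁻¹' U).indicator (fun _ => (1 : ℝ)) | m] =ᵐ[P]
      (X i ⁻¹' U).indicator fun _ => (1 : ℝ) := by
  classical
  let 𝒞 : Set (Set Ω) := {S | ∃ A : ∀ j, Set (α j), (∀ j, MeasurableSet (A j)) ∧ A i = Set.univ ∧
    ∃ C, MeasurableSet[m] C ∧ S = (⋂ j, X j ⁻¹' A j) ∩ C}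
  have h𝒞 : IsPiSystem 𝒞 := by
    rintro _ ⟨A, hA, hAi, C, hC, rfl⟩ _ ⟨A', hA', hAi', C', hC', rfl⟩ -
    refine ⟨fun j => A j ∩ A' j, fun j => (hA j).inter (hA' j), by simp [hAi, hAi'], C ∩ C',
      hC.inter hC', ?_⟩
    simp only [Set.preimage_inter, Set.iInter_inter_distrib]
    exact Set.inter_inter_inter_comm _ _ _ _
  have hle : MeasurableSpace.generateFrom 𝒞 ≤ mΩ := MeasurableSpace.generateFrom_le <| by
    rintro _ ⟨A, hA, -, C, hC, rfl⟩
    exact (MeasurableSet.iInter fun j => hX j (hA j)).inter (hm _ hC)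
  have hmle : m ≤ .generateFrom 𝒞 := fun C hC => MeasurableSpace.measurableSet_generateFrom
    ⟨fun _ => Set.univ, fun _ => MeasurableSet.univ, rfl, C, hC, by simp⟩
  have hXle : ∀ j, j ≠ i → MeasurableSpace.comap (X j) inferInstance ≤ .generateFrom 𝒞 := by
    rintro j hj _ ⟨B, hB, rfl⟩
    refine MeasurableSpace.measurableSet_generateFrom
      ⟨Function.update (fun _ => Set.univ) j B, fun l => ?_, by simp [hj.symm], Set.univ,
        MeasurableSet.univ, ?_⟩
    · rcases eq_or_ne l j with rfl | hl
      · simpa using hB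
      · simp [hl]
    · ext ω
      simp only [Set.mem_preimage, Set.inter_univ, Set.mem_iInter]
      refine ⟨fun hω l => ?_, fun hω => by simpa using hω j⟩
      rcases eq_or_ne l j with rfl | hl
      · simpa using hω
      · simp [hl]
  have hE' : MeasurableSet[.generateFrom 𝒞] E := sup_le hmle (iSup₂_le hXle) E hE
  have hind : (X i ⁻¹' U).indicator (fun _ => (1 : ℝ)) =ᵐ[P] E.indicator fun _ => 1 :=
    indicator_ae_eq_of_ae_eq_set hUE
  have hUint : Integrable ((X i ⁻¹' U).indicator fun _ => (1 : ℝ)) P :=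
    (integrable_const 1).indicator (hX i hU)
  have hEcond : P[E.indicator (fun _ => (1 : ℝ)) | .generateFrom 𝒞] = E.indicator fun _ => 1 :=
    condExp_of_stronglyMeasurable hle (stronglyMeasurable_const.indicator hE')
      ((integrable_const 1).indicator (hle _ hE'))
  refine Filter.EventuallyEq.trans ?_ hind.symm
  rw [← hEcond]
  refine Filter.EventuallyEq.trans ?_ (condExp_congr_ae hind)
  refine ae_eq_condExp_of_forall_setIntegral_eq hle hUint
    (fun _ _ _ => integrable_condExp.integrableOn) (fun S hS _ => ?_)
    (stronglyMeasurable_condExp.mono hmle).aestronglyMeasurable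
  refine MeasurableSpace.induction_on_inter (m := .generateFrom 𝒞) (C := fun S _ =>
    ∫ x in S, (P[(X i ⁻¹' U).indicator (fun _ => (1 : ℝ)) | m]) x ∂P =
      ∫ x in S, (X i ⁻¹' U).indicator (fun _ => (1 : ℝ)) x ∂P) rfl h𝒞 (by simp) ?_ ?_ ?_ S hS
  · rintro _ ⟨A, hA, hAi, C, hC, rfl⟩
    have hR : MeasurableSet (⋂ j, X j ⁻¹' A j) := MeasurableSet.iInter fun j => hX j (hA j)
    have key := condExp_indicator_inter_of_iCondIndepRV hm hX h i hU hA hAi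
    rw [Set.inter_comm, ← setIntegral_indicator hR, ← setIntegral_indicator hR,
      Set.indicator_indicator, Set.inter_comm (⋂ j, X j ⁻¹' A j)]
    refine (setIntegral_condExp hm (integrable_condExp.indicator hR) hC).symm.trans
      (.trans ?_ (setIntegral_condExp hm
        ((integrable_const (1 : ℝ)).indicator ((hX i hU).inter hR)) hC))
    exact setIntegral_congr_ae (hm _ hC) (key.symm.mono fun _ hω _ => hω)
  · intro S hS hSeq
    rw [setIntegral_compl (hle _ hS) integrable_condExp, setIntegral_compl (hle _ hS) hUint,
      hSeq, integral_condExp hm]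
  · intro f hf hfm hfeq
    rw [integral_iUnion (fun n => hle _ (hfm n)) hf integrable_condExp.integrableOn,
      integral_iUnion (fun n => hle _ (hfm n)) hf hUint.integrableOn]
    exact tsum_congr hfeq

theorem exists_measurable_ae_eq_comp_of_condExp_indicator {F : Ω → ℝ}
    (hF : ∀ A : Set ℝ, MeasurableSet A → P[(F ⁻¹' A).indicator (fun _ => (1 : ℝ)) | m] =ᵐ[P]
      (F ⁻¹' A).indicator fun _ => (1 : ℝ)) :
    ∃ (φ : ℝ → ℕ → Bool) (s : Ω → ℕ → Bool), Measurable φ ∧ Function.Injective φ ∧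
      Measurable[m] s ∧ ∀ᵐ ω ∂P, φ (F ω) = s ω := by
  classical
  obtain ⟨φ, hφ, hinj⟩ :=
    MeasurableSpace.measurable_injection_nat_bool_of_countablySeparated ℝ
  let A : ℕ → Set ℝ := fun n => {x | φ x n = true}
  have hA : ∀ n, MeasurableSet (A n) := fun n =>
    ((measurable_pi_apply n).comp hφ) (measurableSet_singleton true)
  let η : ℕ → Ω → ℝ := fun n => P[(F ⁻¹' A n).indicator (fun _ => (1 : ℝ)) | m]
  refine ⟨φ, fun ω n => decide (η n ω = 1), hφ, hinj, ?_, ?_⟩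
  · refine @measurable_pi_lambda _ _ _ m _ _ fun n => ?_
    have hη : Measurable[m] (η n) := stronglyMeasurable_condExp.measurable
    refine @measurable_to_bool _ m _ ?_
    have : (fun ω => decide (η n ω = 1)) ⁻¹' {true} = η n ⁻¹' {1} := by ext; simp
    rw [this]
    exact hη (measurableSet_singleton 1)
  · filter_upwards [ae_all_iff.2 fun n => hF (A n) (hA n)] with ω hω
    ext n
    have : η n ω = (F ⁻¹' A n).indicator (fun _ => (1 : ℝ)) ω := hω n
    rw [this]
    by_cases h : φ (F ω) n = true
    · simp [A, h]
    · simp [A, h]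

theorem ae_ne_of_indepFun_of_injective {W : Type*} [MeasurableSpace W] [IsProbabilityMeasure P]
    {Z : Ω → ℝ} {T : Ω → W} (hZ : Measurable Z) (hT : Measurable T) (hind : IndepFun Z T P)
    [NullSingletonClass (P.map Z)] {φ : ℝ → ℕ → Bool} (hφ : Measurable φ)
    (hinj : Function.Injective φ)
    {r : W → ℝ} (hr : Measurable r) {H : W → ℕ → Bool} (hH : Measurable H) :
    ∀ᵐ ω ∂P, φ (Z ω + r (T ω)) ≠ H (T ω) := by
  have := Measure.isProbabilityMeasure_map (μ := P) hT.aemeasurable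
  have := Measure.isProbabilityMeasure_map (μ := P) hZ.aemeasurable
  let S : Set (ℝ × W) := {x | φ (x.1 + r x.2) = H x.2}
  have hS : MeasurableSet S := by
    simp only [S, funext_iff, Set.ofPred_forall]
    refine MeasurableSet.iInter fun n => measurableSet_eq_fun ?_ ?_
    · exact (measurable_pi_apply n).comp
        (hφ.comp (measurable_fst.add (hr.comp measurable_snd)))
    · exact (measurable_pi_apply n).comp (hH.comp measurable_snd)
  have hprod := (indepFun_iff_map_prod_eq_prod_map_map hZ.aemeasurable hT.aemeasurable).1 hind
  have hnull : (P.map fun ω => (Z ω, T ω)) S = 0 := by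
    rw [hprod, Measure.prod_apply_symm hS]
    refine lintegral_eq_zero_of_ae_eq_zero (ae_of_all _ fun w => ?_)
    refine Set.Subsingleton.measure_zero (fun x hx y hy => ?_) _
    have hx' : φ (x + r w) = H w := hx
    have hy' : φ (y + r w) = H w := hy
    exact add_right_cancel (hinj (hx'.trans hy'.symm))
  rw [Measure.map_apply (hZ.prodMk hT) hS] at hnull
  exact measure_eq_zero_iff_ae_notMem.1 hnull

theorem HasGaussianLaw.indepFun_dotProduct_mulVec {ι : Type*} [Fintype ι] {k : ℕ} {Y : Ω → ι → ℝ}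
    (hY : HasGaussianLaw Y P) (h0 : ∀ p, ∫ ω, Y ω p ∂P = 0) {K : Matrix ι ι ℝ}
    (hK : ∀ p q, K p q = ∫ ω, Y ω p * Y ω q ∂P) (G : Matrix (Fin k) ι ℝ) (w : ι → ℝ)
    (hw : ∀ c, w ⬝ᵥ K *ᵥ G c = 0) : IndepFun (fun ω => w ⬝ᵥ Y ω) (fun ω => G *ᵥ Y ω) P := by
  have := hY.isProbabilityMeasure
  have hlin : HasGaussianLaw
      (fun ω => ((fun _ : Unit => w ⬝ᵥ Y ω), fun c => (G *ᵥ Y ω) c)) P :=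
    hY.map_fun (LinearMap.toContinuousLinearMap
      ((LinearMap.pi fun _ : Unit => dotProductBilin ℝ ℝ w).prod (Matrix.mulVecLin G)))
  have := hlin.indepFun_of_covariance_eval (X := fun _ ω => w ⬝ᵥ Y ω)
    (Y := fun c ω => (G *ᵥ Y ω) c) fun _ c => by
      have h1 : (fun ω => (G *ᵥ Y ω) c) = fun ω => G c ⬝ᵥ Y ω := rfl
      rw [h1, covariance_eq_sub (hY.dotProduct w).memLp_two (hY.dotProduct (G c)).memLp_two,
        integral_dotProduct_eq_zero hY h0, zero_mul, sub_zero, ← hw c,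
        ← integral_dotProduct_mul_dotProduct hY hK]
      rfl
  exact this.comp (φ := fun x : Unit → ℝ => x ()) (ψ := id)
    (measurable_pi_apply ()) measurable_id

theorem dotProduct_mulVec_eq_zero_of_iCondIndepRV [IsProbabilityMeasure P] {n k : ℕ}
    {d : Fin n → ℕ} {X : ∀ i, Ω → Fin (d i) → ℝ} (hX : ∀ i, Measurable (X i)) {V : Ω → ℕ}
    (hV : Measurable V) (G : Matrix (Fin k) ((i : Fin n) × Fin (d i)) ℝ)
    (hcond : iCondIndepRV P (MeasurableSpace.comap
      (fun ω => (V ω, G *ᵥ fun p => X p.1 ω p.2)) inferInstance) X)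
    (hY : HasGaussianLaw (fun ω (p : (i : Fin n) × Fin (d i)) => X p.1 ω p.2) P)
    (h0 : ∀ p : (i : Fin n) × Fin (d i), ∫ ω, X p.1 ω p.2 ∂P = 0)
    {K : Matrix ((i : Fin n) × Fin (d i)) ((i : Fin n) × Fin (d i)) ℝ}
    (hK : ∀ p q, K p q = ∫ ω, X p.1 ω p.2 * X q.1 ω q.2 ∂P) (i : Fin n)
    {u u' : ((i : Fin n) × Fin (d i)) → ℝ} (hu : ∀ p, p.1 ≠ i → u p = 0)
    (hu' : ∀ p, p.1 = i → u' p = 0) {g g' : Fin k → ℝ}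
    (hdep : (u - u' - g ᵥ* G) ⬝ᵥ K *ᵥ (u - u' - g ᵥ* G) = 0)
    (horth : ∀ c, (u - g' ᵥ* G) ⬝ᵥ K *ᵥ G c = 0) :
    (u - g' ᵥ* G) ⬝ᵥ K *ᵥ (u - g' ᵥ* G) = 0 := by
  set Y : Ω → ((i : Fin n) × Fin (d i)) → ℝ := fun ω p => X p.1 ω p.2
  have hYm : Measurable Y := measurable_pi_lambda _ fun p => (measurable_pi_apply p.2).comp (hX p.1)
  set T : Ω → ℕ × (Fin k → ℝ) := fun ω => (V ω, G *ᵥ Y ω)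
  have hGY : Measurable fun ω => G *ᵥ Y ω :=
    (Continuous.matrix_mulVec continuous_const continuous_id).measurable.comp hYm
  have hT : Measurable T := hV.prodMk hGY
  have hd : ∀ w, Measurable fun ω => w ⬝ᵥ Y ω := fun w =>
    (Continuous.dotProduct continuous_const continuous_id).measurable.comp hYm
  by_contra hne
  have hfac : ∀ ω, u ⬝ᵥ Y ω = ∑ j, u ⟨i, j⟩ * X i ω j := fun ω => by
    rw [dotProduct, Fintype.sum_sigma, Fintype.sum_eq_single i]
    intro l hl
    exact Finset.sum_eq_zero fun j _ => by rw [hu ⟨l, j⟩ hl, zero_mul]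
  have hf : Measurable fun x : Fin (d i) → ℝ => ∑ j, u ⟨i, j⟩ * x j := by fun_prop
  have hae : ∀ᵐ ω ∂P, u ⬝ᵥ Y ω = u' ⬝ᵥ Y ω + g ⬝ᵥ G *ᵥ Y ω := by
    have hlaw := map_dotProduct_eq_gaussianReal hY h0 hK (u - u' - g ᵥ* G)
    rw [hdep, Real.toNNReal_zero, gaussianReal_zero_var] at hlaw
    have h1 : ∀ᵐ x ∂(P.map fun ω => (u - u' - g ᵥ* G) ⬝ᵥ Y ω), x = 0 := by
      rw [hlaw]
      simp [ae_dirac_eq]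
    filter_upwards [ae_of_ae_map (hd _).aemeasurable h1] with ω hω
    rw [sub_dotProduct, sub_dotProduct, ← dotProduct_mulVec] at hω
    linarith
  have hF' : Measurable[MeasurableSpace.comap T inferInstance ⊔
      ⨆ j, ⨆ (_ : j ≠ i), MeasurableSpace.comap (X j) inferInstance]
      fun ω => u' ⬝ᵥ Y ω + g ⬝ᵥ G *ᵥ Y ω := by
    refine Measurable.add (Finset.measurable_sum _ fun p _ => ?_) ?_
    · by_cases hp : p.1 = i
      · simp only [hu' p hp, zero_mul]
        exact measurable_const
      · refine Measurable.const_mul ?_ _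
        refine Measurable.mono (ma := MeasurableSpace.comap (X p.1) inferInstance)
          ((measurable_pi_apply p.2).comp (comap_measurable _)) ?_ le_rfl
        exact le_sup_of_le_right (le_iSup₂_of_le p.1 hp le_rfl)
    · refine Measurable.mono (ma := MeasurableSpace.comap T inferInstance)
        (Measurable.comp (g := fun x : ℕ × (Fin k → ℝ) => g ⬝ᵥ x.2) ?_ (comap_measurable T))
        le_sup_left le_rfl
      exact (Continuous.dotProduct continuous_const continuous_id).measurable.comp measurable_snd
  obtain ⟨φ, s, hφ, hinj, hs, hφs⟩ := exists_measurable_ae_eq_comp_of_condExp_indicator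
    (m := MeasurableSpace.comap T inferInstance) (P := P) (F := fun ω => u ⬝ᵥ Y ω) fun A hA => by
      have hpre : (fun ω => u ⬝ᵥ Y ω) ⁻¹' A = X i ⁻¹' ((fun x => ∑ j, u ⟨i, j⟩ * x j) ⁻¹' A) := by
        ext ω
        simp only [Set.mem_preimage, hfac]
      rw [hpre]
      refine condExp_indicator_ae_eq_of_iCondIndepRV hT.comap_le hX hcond i (hf hA) (hF' hA) ?_
      rw [← hpre]
      filter_upwards [hae] with ω hω
      exact congrArg (· ∈ A) hω
  obtain ⟨H, hH, rfl⟩ := hs.exists_eq_measurable_comp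
  have hZ : NullSingletonClass (P.map fun ω => (u - g' ᵥ* G) ⬝ᵥ Y ω) := by
    rw [map_dotProduct_eq_gaussianReal hY h0 hK]
    refine nullSingletonClass_gaussianReal fun h => hne (le_antisymm (Real.toNNReal_eq_zero.1 h) ?_)
    rw [← integral_dotProduct_mul_dotProduct hY hK]
    exact integral_nonneg fun ω => mul_self_nonneg _
  have hind := HasGaussianLaw.indepFun_dotProduct_mulVec hY h0 hK G _ horth
  have hnev : ∀ᵐ ω ∂P, ∀ v, φ ((u - g' ᵥ* G) ⬝ᵥ Y ω + g' ⬝ᵥ G *ᵥ Y ω) ≠ H (v, G *ᵥ Y ω) :=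
    ae_all_iff.2 fun v => ae_ne_of_indepFun_of_injective (hd _) hGY hind hφ hinj
      (r := fun x => g' ⬝ᵥ x) (H := fun x => H (v, x))
      (Continuous.dotProduct continuous_const continuous_id).measurable (by fun_prop)
  obtain ⟨ω, h1, h2⟩ := (hnev.and hφs).exists
  refine h1 (V ω) ?_
  rw [sub_dotProduct, ← dotProduct_mulVec, sub_add_cancel]
  exact h2

end Converse

section CommonInformationDimension

open Module Submodule

theorem Matrix.PosSemidef.exists_gram_eq {ι : Type*} [Fintype ι] {K : Matrix ι ι ℝ}
    (hK : K.PosSemidef) : ∃ a : ι → EuclideanSpace ℝ ι, gram ℝ a = K := by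
  classical
  open scoped MatrixOrder in
  obtain ⟨B, hB⟩ := CStarAlgebra.nonneg_iff_eq_mul_star_self.mp hK.nonneg
  refine ⟨fun p => WithLp.toLp 2 (B p), ?_⟩
  ext p q
  rw [hB, gram_apply, mul_apply, PiLp.inner_apply]
  exact Finset.sum_congr rfl fun j _ => mul_comm _ _

section Span

variable {H : Type*} [NormedAddCommGroup H] [InnerProductSpace ℝ H] {ι : Type*}
  (a : ι → H)

theorem inner_linearCombination_gram [Fintype ι] (u w : ι → ℝ) :
    inner ℝ (Fintype.linearCombination ℝ a u) (Fintype.linearCombination ℝ a w) =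
      u ⬝ᵥ gram ℝ a *ᵥ w := by
  simpa [Fintype.linearCombination_apply] using (star_dotProduct_gram_mulVec a u w).symm

theorem exists_linearCombination_eq_of_mem_span_image [Fintype ι] {s : Set ι} {x : H}
    (hx : x ∈ span ℝ (a '' s)) :
    ∃ u : ι → ℝ, (∀ p, p ∉ s → u p = 0) ∧ Fintype.linearCombination ℝ a u = x := by
  obtain ⟨l, hl, rfl⟩ := (Finsupp.mem_span_image_iff_linearCombination ℝ).1 hx
  exact ⟨l, fun p hp => Finsupp.notMem_support_iff.1 fun h => hp (hl h),
    (Finsupp.linearCombination_eq_fintype_linearCombination_apply ℝ a l).symm.trans (by simp)⟩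

theorem iSup_span_image_fiber {β : Type*} (blk : ι → β) :
    (⨆ i, span ℝ (a '' {p | blk p = i})) = span ℝ (Set.range a) := by
  rw [iSup_span, ← Set.image_iUnion, ← Set.image_univ]
  congr 2
  ext p
  simp

theorem supOthers_span_image_fiber {β : Type*} (blk : ι → β) (i : β) :
    supOthers (fun i => span ℝ (a '' {p | blk p = i})) i = span ℝ (a '' {p | blk p ≠ i}) := by
  simp only [supOthers, iSup_span, ← Set.image_iUnion]
  congr 2
  ext p
  simp

end Span

theorem sum_finrank_supOthers_le_of_simWitnessN {Ω : Type*} [MeasurableSpace Ω] {P : Measure Ω}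
    [IsProbabilityMeasure P] {n k : ℕ} {d : Fin n → ℕ} {X : ∀ i, Ω → Fin (d i) → ℝ}
    (hX : ∀ i, Measurable (X i))
    (hY : HasGaussianLaw (fun ω (p : (i : Fin n) × Fin (d i)) => X p.1 ω p.2) P)
    (hmean : ∀ i j, ∫ ω, X i ω j ∂P = 0)
    {H : Type*} [NormedAddCommGroup H] [InnerProductSpace ℝ H] [FiniteDimensional ℝ H]
    {a : ((i : Fin n) × Fin (d i)) → H}
    (ha : ∀ p q, gram ℝ a p q = ∫ ω, X p.1 ω p.2 * X q.1 ω q.2 ∂P) (w : SimWitnessN P X k)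
    {S : Fin n → Submodule ℝ H} (hS : ∀ i, S i = span ℝ (a '' {p | p.1 = i})) :
    (∑ i, finrank ℝ (supOthers S i)) + finrank ℝ (⨆ i, S i : Submodule ℝ H) ≤
      k + n * finrank ℝ (⨆ i, S i : Submodule ℝ H) := by
  obtain ⟨Ω', P', hP', X', V, G, hX', hV, hlaw, -, hcond⟩ := w
  obtain rfl : S = fun i => span ℝ (a '' {p | p.1 = i}) := funext hS
  have hXm : Measurable fun ω i => X i ω := measurable_pi_lambda _ hX
  have hXm' : Measurable fun ω i => X' i ω := measurable_pi_lambda _ hX'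
  have hunc : Measurable fun (z : ∀ i, Fin (d i) → ℝ) (p : (i : Fin n) × Fin (d i)) => z p.1 p.2 :=
    measurable_pi_lambda _ fun p => (measurable_pi_apply p.2).comp (measurable_pi_apply p.1)
  have hY' : HasGaussianLaw (fun ω (p : (i : Fin n) × Fin (d i)) => X' p.1 ω p.2) P' := by
    refine ⟨?_⟩
    have h := congrArg (Measure.map fun z (p : (i : Fin n) × Fin (d i)) => z p.1 p.2) hlaw
    rw [Measure.map_map hunc hXm', Measure.map_map hunc hXm] at h
    exact h ▸ hY.isGaussian_map
  have hintegral : ∀ f : (∀ i, Fin (d i) → ℝ) → ℝ, Measurable f →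
      ∫ ω, f (fun i => X' i ω) ∂P' = ∫ ω, f (fun i => X i ω) ∂P := fun f hf => by
    rw [← integral_map hXm'.aemeasurable hf.aestronglyMeasurable, hlaw,
      integral_map hXm.aemeasurable hf.aestronglyMeasurable]
  have hev : ∀ p : (i : Fin n) × Fin (d i), Measurable fun z : ∀ i, Fin (d i) → ℝ => z p.1 p.2 :=
    fun p => (measurable_pi_apply p.2).comp (measurable_pi_apply p.1)
  have h0' : ∀ p : (i : Fin n) × Fin (d i), ∫ ω, X' p.1 ω p.2 ∂P' = 0 := fun p =>
    (hintegral _ (hev p)).trans (hmean p.1 p.2)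
  have ha' : ∀ p q, gram ℝ a p q = ∫ ω, X' p.1 ω p.2 * X' q.1 ω q.2 ∂P' := fun p q =>
    (ha p q).trans (hintegral _ ((hev p).mul (hev q))).symm
  set T := Fintype.linearCombination ℝ a
  have hTG : ∀ g : Fin k → ℝ, T (g ᵥ* G) = ∑ c, g c • T (G c) := fun g => by
    simp only [vecMul_eq_sum, map_sum, map_smul]
  set L := span ℝ (Set.range fun c => T (G c))
  have hLk : finrank ℝ L ≤ k := (finrank_range_le_card _).trans_eq (Fintype.card_fin k)
  have hL := sum_finrank_supOthers_le (fun i => span ℝ (a '' {p | p.1 = i})) L ?_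
  · rw [Fintype.card_fin] at hL
    exact hL.trans (Nat.add_le_add_right hLk _)
  intro i x hx y hy hxy
  rw [supOthers_span_image_fiber] at hy
  obtain ⟨u, hu, rfl⟩ := exists_linearCombination_eq_of_mem_span_image a hx
  obtain ⟨u', hu', rfl⟩ := exists_linearCombination_eq_of_mem_span_image a hy
  obtain ⟨g, hg⟩ := (mem_span_range_iff_exists_fun ℝ).1 hxy
  obtain ⟨g', hg'⟩ := (mem_span_range_iff_exists_fun ℝ).1 (L.starProjection_apply_mem (T u))
  rw [← hTG] at hg hg'
  have hzero := dotProduct_mulVec_eq_zero_of_iCondIndepRV hX' hV G hcond hY' h0' ha' i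
    (u := u) (u' := u') (g := g) (g' := g') (fun p hp => hu p hp)
    (fun p hp => hu' p (not_not_intro hp)) ?_ fun c => ?_
  · rw [← inner_linearCombination_gram, inner_self_eq_zero, map_sub, sub_eq_zero] at hzero
    exact hzero ▸ hg' ▸ L.starProjection_apply_mem (T u)
  · rw [← inner_linearCombination_gram, inner_self_eq_zero, map_sub, map_sub, sub_eq_zero]
    exact hg.symm
  · rw [← inner_linearCombination_gram, map_sub]
    refine (mem_orthogonal' L _).1 ?_ _ (subset_span ⟨c, rfl⟩)
    exact hg' ▸ L.sub_starProjection_mem_orthogonal (T u)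

end CommonInformationDimension

/-- **Common information dimension of `n` jointly Gaussian vectors**
(Theorem 2 of the paper): the set of achievable common-randomness dimensions is
nonempty and its minimum equals `(∑ᵢ rank Σ_{−i}) − (n − 1) ⬝ rank Σ`. -/
theorem stmt1 {Ω : Type*} [MeasurableSpace Ω] (P : Measure Ω) [IsProbabilityMeasure P]
    {n : ℕ} (hn : 1 ≤ n) {d : Fin n → ℕ} (X : ∀ i, Ω → Fin (d i) → ℝ)
    (hX : ∀ i, Measurable (X i))
    (hGauss : IsGaussianVec P fun ω (p : (i : Fin n) × Fin (d i)) => X p.1 ω p.2)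
    (hmean : ∀ i j, ∫ ω, X i ω j ∂P = 0)
    (K : Matrix ((i : Fin n) × Fin (d i)) ((i : Fin n) × Fin (d i)) ℝ)
    (hK : ∀ p q, K p q = ∫ ω, X p.1 ω p.2 * X q.1 ω q.2 ∂P)
    (Kneg : ∀ i : Fin n,
      Matrix {p : (j : Fin n) × Fin (d j) // p.1 ≠ i} {p : (j : Fin n) × Fin (d j) // p.1 ≠ i} ℝ)
    (hKneg : ∀ i p q, Kneg i p q = K p.val q.val)
    (D : Set ℕ) (hD : ∀ k, k ∈ D ↔ Nonempty (SimWitnessN P X k)) :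
    D.Nonempty ∧ sInf D = (∑ i, (Kneg i).rank) - (n - 1) * K.rank := by
  have hYm : Measurable fun ω (p : (i : Fin n) × Fin (d i)) => X p.1 ω p.2 :=
    measurable_pi_lambda _ fun p => (measurable_pi_apply p.2).comp (hX p.1)
  have hY := hGauss.hasGaussianLaw hYm
  have hpsd : K.PosSemidef := by
    refine .of_dotProduct_mulVec_nonneg ?_ fun x => ?_
    · ext p q
      simp [hK, mul_comm]
    · rw [star_trivial, ← integral_dotProduct_mul_dotProduct hY hK]
      exact integral_nonneg fun ω => mul_self_nonneg _
  obtain ⟨a, rfl⟩ := hpsd.exists_gram_eq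
  set S : Fin n → Submodule ℝ (EuclideanSpace ℝ ((i : Fin n) × Fin (d i))) :=
    fun i => Submodule.span ℝ (a '' {p | p.1 = i}) with hS
  have hrank : (gram ℝ a).rank = Module.finrank ℝ (⨆ i, S i : Submodule ℝ _) := by
    rw [hS, iSup_span_image_fiber, finrank_span_eq_rank_gram]
  have hrankneg : ∀ i, (Kneg i).rank = Module.finrank ℝ (supOthers S i) := fun i => by
    have h : Kneg i = gram ℝ fun p : {p : (j : Fin n) × Fin (d j) // p.1 ≠ i} => a p := by
      ext p q
      exact hKneg i p q
    rw [hS, supOthers_span_image_fiber, Set.image_eq_range, h, ← finrank_span_eq_rank_gram]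
    rfl
  have : Nonempty (Fin n) := ⟨⟨0, hn⟩⟩
  obtain ⟨m, c, B, M, Γ, G, hΓ, hM, hGB, hGM, hfac⟩ :=
    exists_factorization_gram S a Sigma.fst fun i => rfl
  have hmem := (hD _).2 (nonempty_simWitnessN_of_factorization P X hX hGauss hmean _ hK c B M hΓ hM
    G hGB hGM hfac)
  have hlower : ∀ k ∈ D, (∑ i, Module.finrank ℝ (supOthers S i)) +
      Module.finrank ℝ (⨆ i, S i : Submodule ℝ _) ≤
        k + n * Module.finrank ℝ (⨆ i, S i : Submodule ℝ _) := fun k hk =>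
    sum_finrank_supOthers_le_of_simWitnessN hX hY hmean hK ((hD k).1 hk).some fun i => rfl
  have hupper := finrank_iInf_supOthers_le S
  have hinf := hlower _ (Nat.sInf_mem ⟨_, hmem⟩)
  have hle := Nat.sInf_le hmem
  refine ⟨⟨_, hmem⟩, ?_⟩
  simp only [hrank, hrankneg]
  obtain ⟨l, rfl⟩ : ∃ l, n = l + 1 := ⟨n - 1, by omega⟩
  rw [Fintype.card_fin, add_one_mul] at hupper
  rw [add_one_mul] at hinf
  rw [Nat.add_sub_cancel]
  omega

end
end

section
/- Let d_X, d_Y ≥ 1, let Σ_X ∈ ℝ^{d_X×d_X} and Σ_Y ∈ ℝ^{d_Y×d_Y} be positive definite and Σ_{XY} ∈ ℝ^{d_X×d_Y}. Then there exist constants c > 0 and ε₀ > 0 such that for every ε ∈ (0,ε₀] and every positive definite Σ̂_X ∈ ℝ^{d_X×d_X}, positive definite Σ̂_Y ∈ ℝ^{d_Y×d_Y}, and Σ̂_{XY} ∈ ℝ^{d_X×d_Y} satisfying ‖Σ_X − Σ̂_X‖_F ≤ ε, ‖Σ_Y − Σ̂_Y‖_F ≤ ε, and ‖Σ_{XY}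 − Σ̂_{XY}‖_F ≤ ε, the singular values σ_1 ≥ … ≥ σ_d of Σ_X^{−1/2} Σ_{XY} Σ_Y^{−1/2} and ρ_1 ≥ … ≥ ρ_d of Σ̂_X^{−1/2} Σ̂_{XY} Σ̂_Y^{−1/2} (with d = min(d_X,d_Y)) satisfy (∑_{i=1}^d (σ_i − ρ_i)²)^{1/2} ≤ c·ε. -/
noncomputable section

open Matrix

/-- The Frobenius norm of a matrix: `‖M‖_F = (∑ᵢⱼ Mᵢⱼ²)^{1/2}`. -/
def frobNorm {p q : ℕ} (M : Matrix (Fin p) (Fin q) ℝ) : ℝ :=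
  Real.sqrt (∑ i, ∑ j, (M i j) ^ 2)

/-- `σ : Fin (min p q) → ℝ` is the decreasingly-ordered list of singular values of the
`p × q` real matrix `A`: `σ` is antitone, nonnegative, and `A = U D Vᵀ` for orthogonal
`U`, `V` and the rectangular diagonal matrix `D` with diagonal `σ`. -/
def IsSingularValuesDesc {p q : ℕ} (A : Matrix (Fin p) (Fin q) ℝ)
    (σ : Fin (min p q) → ℝ) : Prop :=
  Antitone σ ∧ (∀ i, 0 ≤ σ i) ∧
    ∃ (U : Matrix (Fin p) (Fin p) ℝ) (V : Matrix (Fin q) (Fin q) ℝ),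
      U * Uᵀ = 1 ∧ V * Vᵀ = 1 ∧
      A = U * (Matrix.of fun (i : Fin p) (j : Fin q) =>
        if h : (i : ℕ) = (j : ℕ) ∧ (i : ℕ) < min p q then σ ⟨(i : ℕ), h.2⟩ else 0) * Vᵀ

open scoped MatrixOrder Matrix.Norms.L2Operator in
lemma Matrix.PosDef.exists_posDef_mul_self_eq {n : Type*} [Fintype n] [DecidableEq n]
    {S : Matrix n n ℝ} (hS : S.PosDef) : ∃ R : Matrix n n ℝ, R.PosDef ∧ R * R = S := by
  obtain ⟨R, hR, h⟩ :=
    CStarAlgebra.isStrictlyPositive_iff_exists_isStrictlyPositive_and_eq_mul_self.1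
      hS.isStrictlyPositive
  exact ⟨R, hR.posDef, h.symm⟩

section FrobeniusPerturbation

open scoped Matrix.Norms.Frobenius

lemma frobenius_norm_sq {m n : Type*} [Fintype m] [Fintype n] (M : Matrix m n ℝ) :
    ‖M‖ ^ 2 = ∑ i, ∑ j, M i j ^ 2 := by
  rw [Matrix.frobenius_norm_def, ← Real.sqrt_eq_rpow, Real.sq_sqrt (by positivity)]
  simp

lemma frobNorm_eq_norm {p q : ℕ} (M : Matrix (Fin p) (Fin q) ℝ) : frobNorm M = ‖M‖ := by
  rw [frobNorm, ← frobenius_norm_sq, Real.sqrt_sq (norm_nonneg _)]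

lemma frobenius_norm_sq_eq_trace {m n : Type*} [Fintype m] [Fintype n] (M : Matrix m n ℝ) :
    ‖M‖ ^ 2 = (Mᵀ * M).trace := by
  rw [frobenius_norm_sq, Finset.sum_comm]
  simp [Matrix.trace, Matrix.mul_apply, sq]

lemma abs_trace_transpose_mul_le {m n : Type*} [Fintype m] [Fintype n] (M N : Matrix m n ℝ) :
    |(Mᵀ * N).trace| ≤ ‖M‖ * ‖N‖ := by
  have h : (Mᵀ * N).trace = ∑ x : n × m, M x.2 x.1 * N x.2 x.1 := by
    simp [Matrix.trace, Matrix.mul_apply, Fintype.sum_prod_type]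
  apply abs_le_of_sq_le_sq _ (by positivity)
  rw [mul_pow, frobenius_norm_sq, frobenius_norm_sq, h, Finset.sum_comm,
    Finset.sum_comm (f := fun i j => N i j ^ 2)]
  simpa [Fintype.sum_prod_type] using Finset.sum_mul_sq_le_sq_mul_sq (Finset.univ : Finset (n × m))
    (fun x => M x.2 x.1) (fun x => N x.2 x.1)

lemma frobenius_norm_orthogonal_mul {m n : Type*} [Fintype m] [DecidableEq m] [Fintype n]
    {U : Matrix m m ℝ} (hU : Uᵀ * U = 1) (M : Matrix m n ℝ) : ‖U * M‖ = ‖M‖ := by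
  rw [← sq_eq_sq₀ (norm_nonneg _) (norm_nonneg _), frobenius_norm_sq_eq_trace,
    frobenius_norm_sq_eq_trace, Matrix.transpose_mul, Matrix.mul_assoc, ← Matrix.mul_assoc Uᵀ, hU,
    Matrix.one_mul]

lemma sum_fin_dite_lt {n p : ℕ} (hnp : n ≤ p) (f : Fin n → ℝ) :
    ∑ i : Fin p, (if h : (i : ℕ) < n then f ⟨i, h⟩ else 0) = ∑ m, f m := by
  obtain ⟨r, rfl⟩ := Nat.exists_eq_add_of_le hnp
  simp [Fin.sum_univ_add]

/-- The rectangular matrix with diagonal `σ`. -/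
def rectDiagonal {p q : ℕ} (σ : Fin (min p q) → ℝ) : Matrix (Fin p) (Fin q) ℝ :=
  Matrix.of fun i j => if h : (i : ℕ) = (j : ℕ) ∧ (i : ℕ) < min p q then σ ⟨(i : ℕ), h.2⟩ else 0

lemma rectDiagonal_mul_apply {p q : ℕ} {n : Type*} (σ : Fin (min p q) → ℝ)
    (a : Matrix (Fin q) n ℝ) (i : Fin p) (l : n) :
    (rectDiagonal σ * a) i l =
      if h : (i : ℕ) < min p q then σ ⟨i, h⟩ * a ⟨i, h.trans_le (min_le_right _ _)⟩ l else 0 := by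
  rw [Matrix.mul_apply]
  split_ifs with h
  · rw [Finset.sum_eq_single ⟨i, h.trans_le (min_le_right _ _)⟩]
    · simp only [rectDiagonal, Matrix.of_apply]
      rw [dif_pos (And.intro trivial h)]
    · intro j _ hj
      simp only [rectDiagonal, Matrix.of_apply]
      rw [dif_neg, zero_mul]
      rintro ⟨h', -⟩
      exact hj (Fin.ext h'.symm)
    · simp
  · refine Finset.sum_eq_zero fun j _ => ?_
    simp only [rectDiagonal, Matrix.of_apply]
    rw [dif_neg fun h' => h h'.2, zero_mul]

lemma norm_sq_rectDiagonal_mul_replicateCol {p q : ℕ} (σ : Fin (min p q) → ℝ) (a : Fin q → ℝ) :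
    ‖rectDiagonal σ * replicateCol Unit a‖ ^ 2 =
      ∑ j : Fin q, if h : (j : ℕ) < min p q then σ ⟨j, h⟩ ^ 2 * a j ^ 2 else 0 := by
  have h₁ := sum_fin_dite_lt (min_le_left p q)
    fun m => σ m ^ 2 * a ⟨m, m.2.trans_le (min_le_right _ _)⟩ ^ 2
  have h₂ := sum_fin_dite_lt (min_le_right p q)
    fun m => σ m ^ 2 * a ⟨m, m.2.trans_le (min_le_right _ _)⟩ ^ 2
  rw [frobenius_norm_sq]
  refine Eq.trans ?_ (h₁.trans h₂.symm)
  refine Finset.sum_congr rfl fun i _ => ?_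
  rw [Fintype.sum_unique, rectDiagonal_mul_apply]
  split_ifs <;> simp [mul_pow]

lemma norm_sq_replicateCol {q : ℕ} (a : Fin q → ℝ) :
    ‖replicateCol Unit a‖ ^ 2 = ∑ j, a j ^ 2 := by
  rw [frobenius_norm_sq]
  simp

lemma mul_norm_le_norm_rectDiagonal_mul {p q : ℕ} {σ : Fin (min p q) → ℝ} (hσ : Antitone σ)
    (hσ₀ : ∀ i, 0 ≤ σ i) (k : Fin (min p q)) {a : Fin q → ℝ}
    (ha : ∀ j : Fin q, (k : ℕ) < j → a j = 0) :
    σ k * ‖replicateCol Unit a‖ ≤ ‖rectDiagonal σ * replicateCol Unit a‖ := by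
  apply le_of_sq_le_sq _ (norm_nonneg _)
  rw [mul_pow, norm_sq_rectDiagonal_mul_replicateCol, norm_sq_replicateCol, Finset.mul_sum]
  refine Finset.sum_le_sum fun j _ => ?_
  rcases lt_or_ge (k : ℕ) j with h | h
  · simp [ha j h]
  · rw [dif_pos (h.trans_lt k.2)]
    have := hσ (show (⟨j, h.trans_lt k.2⟩ : Fin (min p q)) ≤ k from h)
    have := hσ₀ k
    gcongr

lemma norm_rectDiagonal_mul_le {p q : ℕ} {σ : Fin (min p q) → ℝ} (hσ : Antitone σ)
    (hσ₀ : ∀ i, 0 ≤ σ i) (k : Fin (min p q)) {a : Fin q → ℝ}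
    (ha : ∀ j : Fin q, (j : ℕ) < k → a j = 0) :
    ‖rectDiagonal σ * replicateCol Unit a‖ ≤ σ k * ‖replicateCol Unit a‖ := by
  apply le_of_sq_le_sq _ (mul_nonneg (hσ₀ k) (norm_nonneg _))
  rw [mul_pow, norm_sq_rectDiagonal_mul_replicateCol, norm_sq_replicateCol, Finset.mul_sum]
  refine Finset.sum_le_sum fun j _ => ?_
  rcases lt_or_ge (j : ℕ) k with h | h
  · simp [ha j h]
  · split_ifs with hj
    · have := hσ (show k ≤ (⟨j, hj⟩ : Fin (min p q)) from h)
      have := hσ₀ ⟨j, hj⟩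
      gcongr
    · positivity

lemma exists_ne_zero_supported_le_mulVec_supported_ge {q : ℕ} (W : Matrix (Fin q) (Fin q) ℝ)
    (k : Fin q) :
    ∃ a : Fin q → ℝ, a ≠ 0 ∧ (∀ j, k < j → a j = 0) ∧ ∀ j, j < k → (W *ᵥ a) j = 0 := by
  let N : Matrix (Fin q) (Fin q) ℝ :=
    Matrix.of fun i => if i < k then W i else if i = k then 0 else Pi.single i 1
  have hN : N.det = 0 := Matrix.det_eq_zero_of_row_eq_zero k fun j => by simp [N]
  obtain ⟨a, ha, h⟩ := Matrix.exists_mulVec_eq_zero_iff.2 hN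
  refine ⟨a, ha, fun j hj => ?_, fun j hj => ?_⟩
  · simpa [N, Matrix.mulVec, hj.not_gt, hj.ne'] using congrFun h j
  · simpa [N, Matrix.mulVec, hj] using congrFun h j

/-- Weyl's inequality for singular values, with the Frobenius norm as upper bound. -/
lemma IsSingularValuesDesc.sub_le_norm_sub {p q : ℕ} {A B : Matrix (Fin p) (Fin q) ℝ}
    {σ ρ : Fin (min p q) → ℝ} (hA : IsSingularValuesDesc A σ) (hB : IsSingularValuesDesc B ρ)
    (k : Fin (min p q)) : σ k - ρ k ≤ ‖A - B‖ := by
  obtain ⟨hσ, hσ₀, U, V, hU, hV, hAe⟩ := hA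
  obtain ⟨hρ, hρ₀, U', V', hU', hV', hBe⟩ := hB
  change A = U * rectDiagonal σ * Vᵀ at hAe
  change B = U' * rectDiagonal ρ * V'ᵀ at hBe
  rw [mul_eq_one_comm] at hU hU'
  have hVt := mul_eq_one_comm.1 hV
  obtain ⟨a, ha₀, ha, hb⟩ := exists_ne_zero_supported_le_mulVec_supported_ge (V'ᵀ * V)
    ⟨k, k.2.trans_le (min_le_right _ _)⟩
  have hWa : replicateCol Unit ((V'ᵀ * V) *ᵥ a) = V'ᵀ * (V * replicateCol Unit a) := by
    rw [Matrix.replicateCol_mulVec, Matrix.mul_assoc]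
  have hAx : A * (V * replicateCol Unit a) = U * (rectDiagonal σ * replicateCol Unit a) := by
    rw [hAe, Matrix.mul_assoc, ← Matrix.mul_assoc Vᵀ, hVt, Matrix.one_mul, Matrix.mul_assoc]
  have hBx : B * (V * replicateCol Unit a) =
      U' * (rectDiagonal ρ * replicateCol Unit ((V'ᵀ * V) *ᵥ a)) := by
    rw [hBe, hWa, Matrix.mul_assoc, Matrix.mul_assoc]
  have hx : ‖V * replicateCol Unit a‖ = ‖replicateCol Unit a‖ :=
    frobenius_norm_orthogonal_mul hVt _
  have hnb : ‖replicateCol Unit ((V'ᵀ * V) *ᵥ a)‖ = ‖replicateCol Unit a‖ := by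
    rw [hWa, frobenius_norm_orthogonal_mul (by rwa [Matrix.transpose_transpose]), hx]
  have h₁ : σ k * ‖replicateCol Unit a‖ ≤ ‖A * (V * replicateCol Unit a)‖ := by
    rw [hAx, frobenius_norm_orthogonal_mul hU]
    exact mul_norm_le_norm_rectDiagonal_mul hσ hσ₀ k ha
  have h₂ : ‖B * (V * replicateCol Unit a)‖ ≤ ρ k * ‖replicateCol Unit a‖ := by
    rw [hBx, frobenius_norm_orthogonal_mul hU', ← hnb]
    exact norm_rectDiagonal_mul_le hρ hρ₀ k hb
  have h₃ : ‖A * (V * replicateCol Unit a)‖ - ‖B * (V * replicateCol Unit a)‖ ≤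
      ‖A - B‖ * ‖replicateCol Unit a‖ := by
    refine (norm_sub_norm_le _ _).trans ?_
    rw [← Matrix.sub_mul, ← hx]
    exact Matrix.frobenius_norm_mul _ _
  have hpos : 0 < ‖replicateCol Unit a‖ :=
    norm_pos_iff.2 fun h => ha₀ (funext fun j => congrFun (congrFun h j) ())
  refine le_of_mul_le_mul_right ?_ hpos
  linarith

lemma IsSingularValuesDesc.sqrt_sum_sub_sq_le {p q : ℕ} {A B : Matrix (Fin p) (Fin q) ℝ}
    {σ ρ : Fin (min p q) → ℝ} (hA : IsSingularValuesDesc A σ) (hB : IsSingularValuesDesc B ρ) :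
    Real.sqrt (∑ i, (σ i - ρ i) ^ 2) ≤ Real.sqrt (min p q : ℕ) * ‖A - B‖ := by
  rw [← Real.sqrt_sq (norm_nonneg (A - B)), ← Real.sqrt_mul (Nat.cast_nonneg _)]
  refine Real.sqrt_le_sqrt ?_
  have h : ∀ i ∈ Finset.univ, (σ i - ρ i) ^ 2 ≤ ‖A - B‖ ^ 2 := fun i _ => by
    refine sq_le_sq' ?_ (hA.sub_le_norm_sub hB i)
    have := hB.sub_le_norm_sub hA i
    rw [norm_sub_rev] at this
    linarith
  simpa using Finset.sum_le_card_nsmul _ _ _ h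

/-- The square root on positive definite matrices is Lipschitz at each point. -/
lemma Matrix.PosDef.exists_norm_sub_le_mul_norm_sq_sub {n : Type*} [Fintype n] [DecidableEq n]
    {S : Matrix n n ℝ} (hS : S.PosDef) :
    ∃ C : ℝ, 0 ≤ C ∧ ∀ S' : Matrix n n ℝ, S'.PosDef → ‖S - S'‖ ≤ C * ‖S * S - S' * S'‖ := by
  obtain ⟨R, hR, hRS⟩ := hS.exists_posDef_mul_self_eq
  have hRt : Rᵀ = R := by
    simpa [Matrix.IsHermitian, Matrix.conjTranspose_eq_transpose_of_trivial] using hR.isHermitian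
  refine ⟨‖R⁻¹‖ ^ 2, by positivity, fun S' hS' => ?_⟩
  set E := S - S' with hE
  have hEt : Eᵀ = E := by
    have h := hS.isHermitian.sub hS'.isHermitian
    rwa [Matrix.IsHermitian, Matrix.conjTranspose_eq_transpose_of_trivial] at h
  have hinv : ‖E‖ ^ 2 ≤ ‖R⁻¹‖ ^ 2 * (Eᵀ * (S * E)).trace := by
    have h₁ : (Eᵀ * (S * E)).trace = ‖R * E‖ ^ 2 := by
      rw [frobenius_norm_sq_eq_trace, ← hRS, Matrix.transpose_mul, hRt]
      simp only [Matrix.mul_assoc]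
    have h₂ : ‖E‖ ≤ ‖R⁻¹‖ * ‖R * E‖ := by
      have := Matrix.frobenius_norm_mul R⁻¹ (R * E)
      rwa [← Matrix.mul_assoc, Matrix.nonsing_inv_mul _ ((Matrix.isUnit_iff_isUnit_det _).1 hR.isUnit),
        Matrix.one_mul] at this
    rw [h₁, ← mul_pow]
    gcongr
  have hpos : 0 ≤ (Eᵀ * (E * S')).trace := by
    have h := (hS'.posSemidef.mul_mul_conjTranspose_same E).trace_nonneg
    rw [Matrix.conjTranspose_eq_transpose_of_trivial] at h
    rwa [Matrix.trace_mul_comm] at h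
  have hsum : S * E + E * S' = S * S - S' * S' := by
    rw [hE]; noncomm_ring
  have hle : (Eᵀ * (S * E)).trace ≤ ‖E‖ * ‖S * S - S' * S'‖ := by
    have h := (le_abs_self _).trans (abs_trace_transpose_mul_le E (S * S - S' * S'))
    rw [← hsum, Matrix.mul_add, Matrix.trace_add, hsum] at h
    linarith
  rcases (norm_nonneg E).eq_or_lt with h₀ | h₀
  · rw [← h₀]; positivity
  · refine le_of_mul_le_mul_left ?_ h₀
    calc ‖E‖ * ‖E‖ = ‖E‖ ^ 2 := (sq _).symm
      _ ≤ ‖R⁻¹‖ ^ 2 * (‖E‖ * ‖S * S - S' * S'‖) := hinv.trans (by gcongr)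
      _ = _ := by ring

lemma norm_inv_sub_inv_le {n : Type*} [Fintype n] [DecidableEq n] {S S' : Matrix n n ℝ}
    (hS : IsUnit S.det) (hS' : IsUnit S'.det) (h : ‖S - S'‖ * ‖S⁻¹‖ ≤ 1 / 2) :
    ‖S⁻¹ - S'⁻¹‖ ≤ 2 * ‖S⁻¹‖ ^ 2 * ‖S - S'‖ := by
  have hid : S'⁻¹ - S⁻¹ = S'⁻¹ * (S - S') * S⁻¹ := by
    rw [Matrix.mul_sub, Matrix.sub_mul, Matrix.nonsing_inv_mul _ hS', Matrix.mul_assoc,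
      Matrix.mul_nonsing_inv _ hS, Matrix.one_mul, Matrix.mul_one]
  have h₁ : ‖S'⁻¹ - S⁻¹‖ ≤ ‖S'⁻¹‖ * (‖S - S'‖ * ‖S⁻¹‖) := by
    rw [hid, Matrix.mul_assoc]
    refine (Matrix.frobenius_norm_mul _ _).trans ?_
    gcongr
    exact Matrix.frobenius_norm_mul _ _
  have h₂ : ‖S'⁻¹‖ ≤ 2 * ‖S⁻¹‖ := by
    have h₃ := norm_sub_norm_le S'⁻¹ S⁻¹
    have h₄ := mul_le_mul_of_nonneg_left h (norm_nonneg S'⁻¹)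
    linarith
  rw [norm_sub_rev]
  calc _ ≤ _ := h₁
    _ ≤ 2 * ‖S⁻¹‖ * (‖S - S'‖ * ‖S⁻¹‖) := by gcongr
    _ = _ := by ring

/-- The inverse square root on positive definite matrices is locally Lipschitz at each point. -/
lemma Matrix.PosDef.exists_norm_inv_sub_inv_le {n : Type*} [Fintype n] [DecidableEq n]
    {S : Matrix n n ℝ} (hS : S.PosDef) :
    ∃ C δ : ℝ, 0 ≤ C ∧ 0 < δ ∧ ∀ ε ≤ δ, ∀ S' : Matrix n n ℝ, S'.PosDef →
      ‖S * S - S' * S'‖ ≤ ε → ‖S⁻¹ - S'⁻¹‖ ≤ C * ε := by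
  obtain ⟨C, hC, h⟩ := hS.exists_norm_sub_le_mul_norm_sq_sub
  refine ⟨2 * ‖S⁻¹‖ ^ 2 * C, (2 * (C * ‖S⁻¹‖ + 1))⁻¹, by positivity, by positivity,
    fun ε hε S' hS' hd => ?_⟩
  have hE : ‖S - S'‖ ≤ C * ε := (h S' hS').trans (by gcongr)
  have hsmall : ‖S - S'‖ * ‖S⁻¹‖ ≤ 1 / 2 := by
    calc ‖S - S'‖ * ‖S⁻¹‖ ≤ C * (2 * (C * ‖S⁻¹‖ + 1))⁻¹ * ‖S⁻¹‖ := by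
          have := hE.trans (mul_le_mul_of_nonneg_left hε hC)
          gcongr
      _ = (C * ‖S⁻¹‖) / (2 * (C * ‖S⁻¹‖ + 1)) := by ring
      _ ≤ 1 / 2 := by
          have : 0 ≤ C * ‖S⁻¹‖ := by positivity
          rw [div_le_div_iff₀ (by positivity) two_pos]
          linarith
  refine (norm_inv_sub_inv_le ((Matrix.isUnit_iff_isUnit_det _).1 hS.isUnit)
    ((Matrix.isUnit_iff_isUnit_det _).1 hS'.isUnit) hsmall).trans ?_
  rw [mul_assoc _ C]
  gcongr

lemma norm_mul_mul_sub_mul_mul_le {l m n o : Type*} [Fintype l] [Fintype m] [Fintype n] [Fintype o]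
    {P P' : Matrix l m ℝ} {M M' : Matrix m n ℝ} {Q Q' : Matrix n o ℝ} {a b ε : ℝ}
    (ha : 0 ≤ a) (hε₁ : ε ≤ 1) (hP : ‖P - P'‖ ≤ a * ε)
    (hM : ‖M - M'‖ ≤ ε) (hQ : ‖Q - Q'‖ ≤ b * ε) :
    ‖P * M * Q - P' * M' * Q'‖ ≤
      (a * ‖M‖ * ‖Q‖ + (‖P‖ + a) * ‖Q‖ + (‖P‖ + a) * (‖M‖ + 1) * b) * ε := by
  have hε : 0 ≤ ε := (norm_nonneg _).trans hM
  have hid : P * M * Q - P' * M' * Q' =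
      (P - P') * M * Q + P' * (M - M') * Q + P' * M' * (Q - Q') := by
    simp only [Matrix.sub_mul, Matrix.mul_sub]
    abel
  have hmul : ∀ (X : Matrix l m ℝ) (Y : Matrix m n ℝ) (Z : Matrix n o ℝ),
      ‖X * Y * Z‖ ≤ ‖X‖ * ‖Y‖ * ‖Z‖ := fun X Y Z =>
    (Matrix.frobenius_norm_mul _ _).trans (by gcongr; exact Matrix.frobenius_norm_mul _ _)
  have hP' : ‖P'‖ ≤ ‖P‖ + a := by
    have h₁ := norm_sub_norm_le P' P
    rw [norm_sub_rev] at h₁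
    have h₂ := mul_le_mul_of_nonneg_left hε₁ ha
    linarith
  have hM' : ‖M'‖ ≤ ‖M‖ + 1 := by
    have h₁ := norm_sub_norm_le M' M
    rw [norm_sub_rev] at h₁
    linarith
  rw [hid]
  calc _ ≤ ‖P - P'‖ * ‖M‖ * ‖Q‖ + ‖P'‖ * ‖M - M'‖ * ‖Q‖ + ‖P'‖ * ‖M'‖ * ‖Q - Q'‖ :=
        norm_add₃_le.trans (by gcongr <;> apply hmul)
    _ ≤ a * ε * ‖M‖ * ‖Q‖ + (‖P‖ + a) * ε * ‖Q‖ + (‖P‖ + a) * (‖M‖ + 1) * (b * ε) := by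
        gcongr
    _ = _ := by ring

lemma Matrix.PosDef.eq_of_mul_self_eq {n : Type*} [Fintype n] [DecidableEq n]
    {S T : Matrix n n ℝ} (hS : S.PosDef) (hT : T.PosDef) (h : S * S = T * T) : S = T := by
  obtain ⟨C, -, hC⟩ := hS.exists_norm_sub_le_mul_norm_sq_sub
  have h' := hC T hT
  rw [h, sub_self, norm_zero, mul_zero, norm_le_zero_iff, sub_eq_zero] at h'
  exact h'

end FrobeniusPerturbation

/-- **Lemma 12 (lm:relax) of the paper**: Frobenius-norm perturbations of size `ε` of
the covariance blocks perturb the decreasingly-ordered singular values of the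
normalized cross-covariance `Σ_X^{−1/2} Σ_{XY} Σ_Y^{−1/2}` by at most `c ⬝ ε` in
Euclidean norm, for some constant `c` and all small enough `ε`. -/
theorem stmt17 {dX dY : ℕ} (hdX : 1 ≤ dX) (hdY : 1 ≤ dY)
    (KX : Matrix (Fin dX) (Fin dX) ℝ) (KY : Matrix (Fin dY) (Fin dY) ℝ)
    (KXY : Matrix (Fin dX) (Fin dY) ℝ)
    (hKX : KX.PosDef) (hKY : KY.PosDef) :
    ∃ (c ε₀ : ℝ), 0 < c ∧ 0 < ε₀ ∧
      ∀ ε : ℝ, 0 < ε → ε ≤ ε₀ →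
      ∀ (KX' : Matrix (Fin dX) (Fin dX) ℝ) (KY' : Matrix (Fin dY) (Fin dY) ℝ)
        (KXY' : Matrix (Fin dX) (Fin dY) ℝ),
        KX'.PosDef → KY'.PosDef →
        frobNorm (KX - KX') ≤ ε → frobNorm (KY - KY') ≤ ε → frobNorm (KXY - KXY') ≤ ε →
        ∀ (SX SX' : Matrix (Fin dX) (Fin dX) ℝ) (SY SY' : Matrix (Fin dY) (Fin dY) ℝ),
          SX.PosDef → SX * SX = KX → SY.PosDef → SY * SY = KY →
          SX'.PosDef → SX' * SX' = KX' → SY'.PosDef → SY' * SY' = KY' →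
          ∀ (σ ρ : Fin (min dX dY) → ℝ),
            IsSingularValuesDesc (SX⁻¹ * KXY * SY⁻¹) σ →
            IsSingularValuesDesc (SX'⁻¹ * KXY' * SY'⁻¹) ρ →
            Real.sqrt (∑ i, (σ i - ρ i) ^ 2) ≤ c * ε := by
  obtain ⟨TX, hTX, rfl⟩ := hKX.exists_posDef_mul_self_eq
  obtain ⟨TY, hTY, rfl⟩ := hKY.exists_posDef_mul_self_eq
  obtain ⟨a, δa, ha, hδa, hA⟩ := hTX.exists_norm_inv_sub_inv_le
  obtain ⟨b, δb, hb, hδb, hB⟩ := hTY.exists_norm_inv_sub_inv_le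
  let nX := frobNorm TX⁻¹
  let nY := frobNorm TY⁻¹
  let nXY := frobNorm KXY
  have hnX : 0 ≤ nX := Real.sqrt_nonneg _
  have hnY : 0 ≤ nY := Real.sqrt_nonneg _
  have hnXY : 0 ≤ nXY := Real.sqrt_nonneg _
  let c := a * nXY * nY + (nX + a) * nY + (nX + a) * (nXY + 1) * b
  refine ⟨Real.sqrt (min dX dY : ℕ) * c + 1, min 1 (min δa δb), by positivity,
    by positivity, ?_⟩
  intro ε hε hε₀ KX' KY' KXY' _ _ hKX' hKY' hKXY' SX SX' SY SY' hSX hSXe hSY hSYe hSX' hSXe'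
    hSY' hSYe' σ ρ hσ hρ
  obtain rfl := hSX.eq_of_mul_self_eq hTX hSXe
  obtain rfl := hSY.eq_of_mul_self_eq hTY hSYe
  subst hSXe' hSYe'
  rw [frobNorm_eq_norm] at hKX' hKY' hKXY'
  have h := norm_mul_mul_sub_mul_mul_le ha (hε₀.trans (min_le_left _ _))
    (hA ε (hε₀.trans ((min_le_right _ _).trans (min_le_left _ _))) SX' hSX' hKX') hKXY'
    (hB ε (hε₀.trans ((min_le_right _ _).trans (min_le_right _ _))) SY' hSY' hKY')
  simp only [← frobNorm_eq_norm] at h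
  have h₁ := hσ.sqrt_sum_sub_sq_le hρ
  rw [← frobNorm_eq_norm] at h₁
  have h₂ := mul_le_mul_of_nonneg_left h (Real.sqrt_nonneg (min dX dY : ℕ))
  calc _ ≤ _ := h₁.trans h₂
    _ = Real.sqrt (min dX dY : ℕ) * c * ε := by ring
    _ ≤ _ := by gcongr; linarith

end
end
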